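/- arXiv:2402.12014 — 4 statements merged into one kernel-verified Lean document; each statement's English description precedes it below -/
import Mathlib

section
/- A tournament T is 3-dicritical if and only if T is isomorphic to R(C3,C3) or to the Paley tournament P7 on seven vertices; in particular there are exactly two 3-dicritical tournaments. -/
/-- A (loopless, simple) digraph on vertex type `V`. -/
structure SimpleDigraph (V : Type) where
  Adj : V → V → Prop
  loopless : ∀ v, ¬ Adj v v

namespace SimpleDigraph

/-- A set of arcs (given as a relation) is acyclic if it admits no directed closed walk. -/
def AcyclicRel {V : Type} (A : V → V → Prop) : Prop :=
  ∀ v, ¬ Relation.TransGen A v v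

/-- A set of arcs is 2-dicolourable if the vertices can be coloured with two colours
so that each colour class induces an acyclic subdigraph. -/
def Dicolourable2Rel {V : Type} (A : V → V → Prop) : Prop :=
  ∃ φ : V → Fin 2, ∀ i : Fin 2,
    AcyclicRel (fun a b => A a b ∧ φ a = i ∧ φ b = i)

/-- A digraph is 2-dicolourable if its vertices can be coloured with two colours
so that each colour class induces an acyclic subdigraph. -/
def Dicolourable2 {V : Type} (D : SimpleDigraph V) : Prop :=
  Dicolourable2Rel D.Adj

/-- `(S, A)` describes a subdigraph of `D`: its vertex set is `S` and its arcs
are given by `A`, which must join vertices of `S` and be arcs of `D`. -/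
def IsSubdigraphOn {V : Type} (D : SimpleDigraph V) (S : Set V) (A : V → V → Prop) : Prop :=
  ∀ u v, A u v → u ∈ S ∧ v ∈ S ∧ D.Adj u v

/-- `D` is 3-dicritical: `D` is not 2-dicolourable, but every proper subdigraph of `D`
(one missing a vertex or an arc) is 2-dicolourable. -/
def Dicritical3 {V : Type} (D : SimpleDigraph V) : Prop :=
  ¬ D.Dicolourable2 ∧
    ∀ (S : Set V) (A : V → V → Prop), D.IsSubdigraphOn S A →
      (S ≠ Set.univ ∨ A ≠ D.Adj) → Dicolourable2Rel A

/-- A digraph is semi-complete if any two distinct vertices are joined by at least one arc. -/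
def SemiComplete {V : Type} (D : SimpleDigraph V) : Prop :=
  ∀ u v : V, u ≠ v → D.Adj u v ∨ D.Adj v u

/-- A tournament is a semi-complete digraph with no digon. -/
def IsTournament {V : Type} (D : SimpleDigraph V) : Prop :=
  D.SemiComplete ∧ ∀ u v : V, ¬ (D.Adj u v ∧ D.Adj v u)

/-- Isomorphism of digraphs. -/
def Iso {V W : Type} (D : SimpleDigraph V) (E : SimpleDigraph W) : Prop :=
  ∃ e : V ≃ W, ∀ u v : V, D.Adj u v ↔ E.Adj (e u) (e v)

/-- `D` contains (a copy of) `H` as a subdigraph. -/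
def ContainsSub {V W : Type} (D : SimpleDigraph V) (H : SimpleDigraph W) : Prop :=
  ∃ f : W → V, Function.Injective f ∧ ∀ a b, H.Adj a b → D.Adj (f a) (f b)

/-- `D` contains (a copy of) `H` as an induced subdigraph. -/
def ContainsInduced {V W : Type} (D : SimpleDigraph V) (H : SimpleDigraph W) : Prop :=
  ∃ f : W → V, Function.Injective f ∧ ∀ a b, H.Adj a b ↔ D.Adj (f a) (f b)

end SimpleDigraph

/-- An auxiliary constructor: the digraph on `Fin n` whose arcs are the pairs in `l`. -/
def digraphOfPairs (n : ℕ) (l : List (ℕ × ℕ)) (h : ∀ v : Fin n, (v.val, v.val) ∉ l) :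
    SimpleDigraph (Fin n) :=
  ⟨fun u v => (u.val, v.val) ∈ l, h⟩

/-- The bidirected complete graph `↔K2` on two vertices (a digon). -/
def biK2 : SimpleDigraph (Fin 2) :=
  ⟨fun u v => u ≠ v, fun v h => h rfl⟩

/-- The bidirected complete graph `↔K3` on three vertices. -/
def biK3 : SimpleDigraph (Fin 3) :=
  ⟨fun u v => u ≠ v, fun v h => h rfl⟩

/-- The directed cycle `C3` on three vertices. -/
def dirC3 : SimpleDigraph (Fin 3) :=
  ⟨fun u v => v = u + 1, by decide⟩

/-- The directed wheel `W3`: a directed triangle `0 → 1 → 2 → 0` together with a hub `3`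
joined by a digon to each triangle vertex. -/
def dirW3 : SimpleDigraph (Fin 4) :=
  digraphOfPairs 4 [(3,0),(0,3),(3,1),(1,3),(3,2),(2,3),(0,1),(1,2),(2,0)] (by decide)

/-- The digraph `H5` on vertices `u0, …, u4`: digons between `u0,u1` and between `u0,u4`,
and simple arcs `u4u1, u1u3, u1u2, u3u4, u2u4, u3u0, u0u2, u2u3`. -/
def digraphH5 : SimpleDigraph (Fin 5) :=
  digraphOfPairs 5 [(0,1),(1,0),(0,4),(4,0),(4,1),(1,3),(1,2),(3,4),(2,4),(3,0),(0,2),(2,3)]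
    (by decide)

/-- The Paley tournament `P7` on `ℤ/7ℤ`: an arc from `i` to `j` iff `j - i ∈ {1, 2, 4}`. -/
def dirP7 : SimpleDigraph (Fin 7) :=
  ⟨fun i j => j - i = 1 ∨ j - i = 2 ∨ j - i = 4, by decide⟩

/-- The rotative digraph `R(↔K2, ↔K2)`: digons `{0,1}` and `{2,3}`, all arcs from `{0,1}`
to `{2,3}`, all arcs from `{2,3}` to the extra vertex `4`, all arcs from `4` to `{0,1}`. -/
def rotK2K2 : SimpleDigraph (Fin 5) :=
  digraphOfPairs 5 [(0,1),(1,0),(2,3),(3,2),(0,2),(0,3),(1,2),(1,3),(2,4),(3,4),(4,0),(4,1)]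
    (by decide)

/-- The rotative digraph `R(↔K2, C3)`. -/
def rotK2C3 : SimpleDigraph (Fin 6) :=
  digraphOfPairs 6 [(0,1),(1,0),(2,3),(3,4),(4,2),(0,2),(0,3),(0,4),(1,2),(1,3),(1,4),
    (2,5),(3,5),(4,5),(5,0),(5,1)] (by decide)

/-- The rotative digraph `R(C3, ↔K2)`. -/
def rotC3K2 : SimpleDigraph (Fin 6) :=
  digraphOfPairs 6 [(0,1),(1,2),(2,0),(3,4),(4,3),(0,3),(0,4),(1,3),(1,4),(2,3),(2,4),
    (3,5),(4,5),(5,0),(5,1),(5,2)] (by decide)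

/-- The rotative digraph `R(C3, C3)`. -/
def rotC3C3 : SimpleDigraph (Fin 7) :=
  digraphOfPairs 7 [(0,1),(1,2),(2,0),(3,4),(4,5),(5,3),(0,3),(0,4),(0,5),(1,3),(1,4),(1,5),
    (2,3),(2,4),(2,5),(3,6),(4,6),(5,6),(6,0),(6,1),(6,2)] (by decide)

namespace SimpleDigraph

/-! ### Colourings without monochromatic cyclic triangles -/

/-- The colouring `φ` has no monochromatic cyclic triangle of the relation `A`. -/
def NoMonoTriangle {V : Type} (A : V → V → Prop) (φ : V → Fin 2) : Prop :=
  ∀ a b c, A a b → A b c → A c a → φ a = φ b → φ b = φ c → False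

/-- The relation obtained from `A` by reversing the arc from `u` to `v`. -/
def ReverseArc {V : Type} (A : V → V → Prop) (u v : V) (x y : V) : Prop :=
  (A x y ∧ ¬(x = u ∧ y = v)) ∨ (x = v ∧ y = u)

theorem NoMonoTriangle.dicolourable {V : Type} {A : V → V → Prop} {φ : V → Fin 2}
    (h : NoMonoTriangle A φ) (total : ∀ u v, u ≠ v → A u v ∨ A v u)
    (asymm : ∀ u v, A u v → ¬ A v u) : Dicolourable2Rel A := by
  refine ⟨φ, fun i v hv => ?_⟩
  have key : ∀ a b, Relation.TransGen (fun a b => A a b ∧ φ a = i ∧ φ b = i) a b →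
      A a b ∧ φ a = i ∧ φ b = i := by
    intro a b hab
    induction hab with
    | single h => exact h
    | @tail b c _ hbc ih =>
      obtain ⟨h1, h2, h3⟩ := ih
      obtain ⟨h4, -, h5⟩ := hbc
      refine ⟨?_, h2, h5⟩
      have hac : a ≠ c := by
        rintro rfl
        exact asymm _ _ h1 h4
      rcases total a c hac with h | hca
      · exact h
      · exact (h a b c h1 h4 hca (by rw [h2, h3]) (by rw [h3, h5])).elim
  have h1 := (key v v hv).1
  exact asymm v v h1 h1

theorem AcyclicRel.noMonoTriangle {V : Type} {A : V → V → Prop} {φ : V → Fin 2}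
    (h : ∀ i, AcyclicRel (fun a b => A a b ∧ φ a = i ∧ φ b = i)) : NoMonoTriangle A φ :=
  fun a _ _ hab hbc hca h1 h2 => h (φ a) a <|
    ((Relation.TransGen.single ⟨hab, rfl, h1.symm⟩).tail
      ⟨hbc, h1.symm, (h1.trans h2).symm⟩).tail ⟨hca, (h1.trans h2).symm, rfl⟩

theorem NoMonoTriangle.dicolourable2 {V : Type} {T : SimpleDigraph V} (hT : T.IsTournament)
    {φ : V → Fin 2} (h : NoMonoTriangle T.Adj φ) : T.Dicolourable2 :=
  h.dicolourable hT.1 fun u v huv hvu => hT.2 u v ⟨huv, hvu⟩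

theorem reverseArc_total {V : Type} {T : SimpleDigraph V} (hT : T.IsTournament) {u v : V}
    (x y : V) (hxy : x ≠ y) :
    ReverseArc T.Adj u v x y ∨ ReverseArc T.Adj u v y x := by
  have := hT.1 x y hxy
  unfold ReverseArc
  tauto

theorem reverseArc_asymm {V : Type} {T : SimpleDigraph V} (hT : T.IsTournament) {u v : V}
    (huv : T.Adj u v) (x y : V) :
    ReverseArc T.Adj u v x y → ¬ ReverseArc T.Adj u v y x := by
  have h1 := hT.2 x y
  have h2 : u ≠ v := fun h => T.loopless v (h ▸ huv)
  unfold ReverseArc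
  grind

/-- In a tournament that is not 2-dicolourable, a colouring that is good up to reversing the arc
`uv` has a monochromatic cyclic triangle through `uv`. -/
theorem exists_triangle_of_reverseArc {V : Type} {A B : V → V → Prop} {φ : V → Fin 2} {u v : V}
    (hA : ¬ NoMonoTriangle A φ) (hB : NoMonoTriangle B φ)
    (hAB : ∀ x y, A x y → ¬(x = u ∧ y = v) → B x y) :
    ∃ w, A v w ∧ A w u ∧ φ u = φ v ∧ φ w = φ u := by
  unfold NoMonoTriangle at hA
  push Not at hA
  obtain ⟨a, b, c, hab, hbc, hca, h1, h2, -⟩ := hA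
  by_cases e1 : a = u ∧ b = v
  · obtain ⟨rfl, rfl⟩ := e1
    exact ⟨c, hbc, hca, h1, (h1.trans h2).symm⟩
  by_cases e2 : b = u ∧ c = v
  · obtain ⟨rfl, rfl⟩ := e2
    exact ⟨a, hca, hab, h2, h1⟩
  by_cases e3 : c = u ∧ a = v
  · obtain ⟨rfl, rfl⟩ := e3
    exact ⟨b, hab, hbc, (h1.trans h2).symm, h2⟩
  exact (hB a b c (hAB _ _ hab e1) (hAB _ _ hbc e2) (hAB _ _ hca e3) h1 h2).elim

theorem NoMonoTriangle.normalize {V : Type} {A : V → V → Prop} {φ : V → Fin 2}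
    (h : NoMonoTriangle A φ) (u : V) :
    NoMonoTriangle A fun x => if φ x = φ u then 0 else 1 := by
  intro a b c hab hbc hca h1 h2
  dsimp only at h1 h2
  refine h a b c hab hbc hca ?_ ?_ <;> revert h1 h2 <;>
    generalize φ a = i <;> generalize φ b = j <;> generalize φ c = k <;> generalize φ u = l <;>
    revert i j k l <;> decide

theorem Dicritical3.exists_colouring {V : Type} {T : SimpleDigraph V} (hT : T.IsTournament)
    (hc : T.Dicritical3) {u v : V} (huv : T.Adj u v) :
    ∃ φ : V → Fin 2, NoMonoTriangle (ReverseArc T.Adj u v) φ ∧ φ u = 0 ∧ φ v = 0 ∧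
      ∃ w, T.Adj v w ∧ T.Adj w u ∧ φ w = 0 := by
  obtain ⟨φ, hφ⟩ := hc.2 Set.univ (fun x y => T.Adj x y ∧ ¬(x = u ∧ y = v))
    (fun x y h => ⟨trivial, trivial, h.1⟩)
    (Or.inr fun h => by
      have := congrFun (congrFun h u) v
      simp [huv] at this)
  have hB := AcyclicRel.noMonoTriangle hφ
  obtain ⟨w, hvw, hwu, huv', hw⟩ := exists_triangle_of_reverseArc (u := u) (v := v)
    (fun h => hc.1 (h.dicolourable2 hT)) hB (fun x y h1 h2 => ⟨h1, h2⟩)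
  have no : ∀ z, T.Adj u z → T.Adj z v → φ z = φ u → False := by
    intro z huz hzv hz
    have n1 : ¬(v = u ∧ w = v) := fun h => T.loopless v (h.1 ▸ huv)
    have n2 : ¬(w = u ∧ u = v) := fun h => T.loopless v (h.2 ▸ huv)
    have n3 : ¬(u = u ∧ z = v) := fun h => T.loopless v (h.2 ▸ hzv)
    have n4 : ¬(z = u ∧ v = v) := fun h => T.loopless u (h.1 ▸ huz)
    exact hφ (φ u) v <|
      (((Relation.TransGen.single ⟨⟨hvw, n1⟩, huv'.symm, hw⟩).tail
        ⟨⟨hwu, n2⟩, hw, rfl⟩).tail ⟨⟨huz, n3⟩, rfl, hz⟩).tail ⟨⟨hzv, n4⟩, hz, huv'.symm⟩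
  have hR : NoMonoTriangle (ReverseArc T.Adj u v) φ := by
    have l := T.loopless
    rintro a b c (hab | ⟨rfl, rfl⟩) (hbc | ⟨rfl, rfl⟩) (hca | ⟨h3, h4⟩) h1 h2
    · exact hB a b c hab hbc hca h1 h2
    · subst h3 h4
      exact no b hab.1 hbc.1 h1.symm
    · exact no a hca.1 hab.1 (h1.trans h2)
    · grind
    · exact no c hbc.1 hca.1 h2.symm
    all_goals grind
  refine ⟨_, hR.normalize u, by simp, by simp [huv'], w, hvw, hwu, by simp [hw]⟩

theorem Dicritical3.exists_colouring_compl {V : Type} {T : SimpleDigraph V}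
    (hc : T.Dicritical3) (v : V) :
    ∃ φ : V → Fin 2, NoMonoTriangle (fun x y => T.Adj x y ∧ x ≠ v ∧ y ≠ v) φ := by
  obtain ⟨φ, hφ⟩ := hc.2 {v}ᶜ (fun x y => T.Adj x y ∧ x ≠ v ∧ y ≠ v)
    (fun x y h => ⟨h.2.1, h.2.2, h.1⟩)
    (Or.inl fun h => by simpa using Set.ext_iff.1 h v)
  exact ⟨φ, AcyclicRel.noMonoTriangle hφ⟩

theorem dicritical3_of_reverseArc {V : Type} {T : SimpleDigraph V} (hT : T.IsTournament)
    (h : ∀ φ, ¬ NoMonoTriangle T.Adj φ)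
    (hrev : ∀ u v, T.Adj u v → ∃ φ, NoMonoTriangle (ReverseArc T.Adj u v) φ) :
    T.Dicritical3 := by
  have hnot : ¬ T.Dicolourable2 := fun ⟨φ, hφ⟩ => h φ (AcyclicRel.noMonoTriangle hφ)
  refine ⟨hnot, fun S A hA hne => ?_⟩
  by_cases hAT : A = T.Adj
  · have hS : S ≠ Set.univ := by tauto
    obtain ⟨v, hv⟩ := (Set.ne_univ_iff_exists_notMem S).1 hS
    have hall : ∀ a, a = v := fun a => by
      by_contra hav
      rcases hT.1 a v hav with h1 | h1 <;> rw [← hAT] at h1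
      exacts [hv (hA _ _ h1).2.1, hv (hA _ _ h1).1]
    refine (h (fun _ => 0) fun a b _ hab _ _ _ _ => ?_).elim
    rw [hall a, hall b] at hab
    exact T.loopless v hab
  · obtain ⟨u, v, huv, hAuv⟩ : ∃ u v, T.Adj u v ∧ ¬ A u v := by
      by_contra! hcon
      exact hAT (funext₂ fun x y => propext ⟨fun hxy => (hA _ _ hxy).2.2, hcon x y⟩)
    obtain ⟨φ, hφ⟩ := hrev u v huv
    obtain ⟨ψ, hψ⟩ := hφ.dicolourable (reverseArc_total hT) (reverseArc_asymm hT huv)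
    refine ⟨ψ, fun i x hx => hψ i x (Relation.TransGen.mono ?_ _ _ hx)⟩
    rintro a b ⟨hab, h2⟩
    refine ⟨Or.inl ⟨(hA _ _ hab).2.2, ?_⟩, h2⟩
    rintro ⟨rfl, rfl⟩
    exact hAuv hab

/-! ### Coded tournaments

A tournament on `{0, …, n - 1}` is coded by a list of `n` bit masks, the `j`-th of which tells which
of the vertices `i < j` are dominated by `j`. -/

/-- Whether `i` dominates `j` in the tournament coded by `s`. -/
def beats (s : List ℕ) (i j : ℕ) : Bool :=
  if i < j then !(s.getD j 0).testBit i else if j < i then (s.getD i 0).testBit j else false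

/-- The arc relation `g` after reversing the arc from `u` to `v`. -/
def flipArc (g : ℕ → ℕ → Bool) (u v i j : ℕ) : Bool :=
  if i = u ∧ j = v then false else if i = v ∧ j = u then true else g i j

/-- Whether no cyclic triangle of `g` consists of `x` and two vertices of `C`. -/
def fits (g : ℕ → ℕ → Bool) (x : ℕ) (C : List ℕ) : Bool :=
  C.all fun i => !g x i || C.all fun j => !(g i j && g j x)

/-- Backtracking search for a way to add the vertices of a list to the colour classes `C` and `D`
without creating monochromatic cyclic triangles. -/
def splits (g : ℕ → ℕ → Bool) : List ℕ → List ℕ → List ℕ → Bool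
  | [], _, _ => true
  | x :: L, C, D => (fits g x C && splits g L (x :: C) D) || (fits g x D && splits g L C (x :: D))

/-- Whether the tournament coded by `s` with the arc `uv` reversed has a colouring without
monochromatic cyclic triangle in which the vertices of `C` get the same colour. -/
def splitsArc (s : List ℕ) (u v : ℕ) (C : List ℕ) : Bool :=
  splits (flipArc (beats s) u v) ((List.range s.length).filter fun x => !C.contains x) C []

/-- Whether the bit mask `m` is a colouring of `{0, …, n - 1}` without monochromatic cyclic
triangle of `g`. -/
def isColouring (g : ℕ → ℕ → Bool) (n m : ℕ) : Bool :=
  (List.range n).all fun i => (List.range n).all fun j =>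
    m.testBit i != m.testBit j || !g i j ||
      (List.range n).all fun k => !(g j k && g k i) || m.testBit j != m.testBit k

/-- Whether `g` has a transitive subtournament with `k` vertices from the list. -/
def hasTransitive (g : ℕ → ℕ → Bool) : ℕ → List ℕ → Bool
  | 0, _ => true
  | k + 1, L => L.any fun x => hasTransitive g k (L.filter (g x))

/-- The vertices of `T` listed by `f` induce the tournament coded by `s`. -/
structure Realizes {V : Type} (T : SimpleDigraph V) (s : List ℕ) (f : ℕ → V) : Prop where
  inj : ∀ i < s.length, ∀ j < s.length, f i = f j → i = j
  adj : ∀ i < s.length, ∀ j < s.length, (T.Adj (f i) (f j) ↔ beats s i j = true)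

theorem Realizes.adj_of_flipArc {V : Type} {T : SimpleDigraph V} {s : List ℕ} {f : ℕ → V}
    (h : Realizes T s f) {u v i j : ℕ} (hi : i < s.length) (hj : j < s.length)
    (hij : flipArc (beats s) u v i j = true) (hu : u < s.length) (hv : v < s.length) :
    ReverseArc T.Adj (f u) (f v) (f i) (f j) := by
  unfold flipArc at hij
  unfold ReverseArc
  split_ifs at hij with h1 h2
  · exact Or.inr ⟨by rw [h2.1], by rw [h2.2]⟩
  · exact Or.inl ⟨(h.adj i hi j hj).2 hij, fun h3 => h1 ⟨h.inj _ hi _ hu h3.1, h.inj _ hj _ hv h3.2⟩⟩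

theorem splits_of_colouring {g : ℕ → ℕ → Bool} {n : ℕ} {c : ℕ → Fin 2}
    (hc : ∀ i < n, ∀ j < n, ∀ k < n, g i j = true → g j k = true → g k i = true →
      c i = c j → c j = c k → False) :
    ∀ L C D : List ℕ, (∀ x ∈ L, x < n) → (∀ x ∈ C, x < n ∧ c x = 0) → (∀ x ∈ D, x < n ∧ c x = 1) →
      splits g L C D = true := by
  have hfit : ∀ x < n, ∀ C : List ℕ, (∀ y ∈ C, y < n ∧ c y = c x) → fits g x C = true := by
    intro x hx C hC
    simp only [fits, List.all_eq_true, Bool.or_eq_true, Bool.not_eq_true', ← Bool.not_eq_true,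
      Bool.and_eq_true]
    intro i hi
    by_contra! hcon
    obtain ⟨hxi, j, hj, hij, hjx⟩ := hcon
    exact hc x hx i (hC i hi).1 j (hC j hj).1 hxi hij hjx (hC i hi).2.symm
      ((hC i hi).2.trans (hC j hj).2.symm)
  intro L
  induction L with
  | nil => intros; rfl
  | cons x L ih =>
    intro C D hL hC hD
    have hx : x < n := hL x (by simp)
    have hL' : ∀ y ∈ L, y < n := fun y hy => hL y (by simp [hy])
    simp only [splits, Bool.or_eq_true, Bool.and_eq_true]
    rcases (by omega : c x = 0 ∨ c x = 1) with h | h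
    · refine Or.inl ⟨hfit x hx C fun y hy => ⟨(hC y hy).1, by rw [(hC y hy).2, h]⟩,
        ih _ _ hL' ?_ hD⟩
      rintro y (_ | ⟨_, hy⟩)
      exacts [⟨hx, h⟩, hC y hy]
    · refine Or.inr ⟨hfit x hx D fun y hy => ⟨(hD y hy).1, by rw [(hD y hy).2, h]⟩,
        ih _ _ hL' hC ?_⟩
      rintro y (_ | ⟨_, hy⟩)
      exacts [⟨hx, h⟩, hD y hy]

theorem Realizes.splits {V : Type} {T : SimpleDigraph V} {s : List ℕ} {f : ℕ → V}
    (h : Realizes T s f) {φ : V → Fin 2} (hφ : NoMonoTriangle T.Adj φ) :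
    splits (beats s) (List.range s.length) [] [] = true := by
  refine splits_of_colouring (n := s.length) (c := φ ∘ f) ?_ _ _ _ (by simp) (by simp) (by simp)
  intro i hi j hj k hk h1 h2 h3
  exact hφ _ _ _ ((h.adj i hi j hj).2 h1) ((h.adj j hj k hk).2 h2) ((h.adj k hk i hi).2 h3)

theorem Realizes.splitsArc {V : Type} {T : SimpleDigraph V} {s : List ℕ} {f : ℕ → V}
    (h : Realizes T s f) {u v : ℕ} (hu : u < s.length) (hv : v < s.length) {φ : V → Fin 2}
    (hφ : NoMonoTriangle (ReverseArc T.Adj (f u) (f v)) φ) {C : List ℕ}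
    (hC : ∀ x ∈ C, x < s.length ∧ φ (f x) = 0) : splitsArc s u v C = true := by
  refine splits_of_colouring (n := s.length) (c := φ ∘ f) ?_ _ _ _ (by simp; tauto) hC (by simp)
  intro i hi j hj k hk h1 h2 h3
  exact hφ _ _ _ (h.adj_of_flipArc hi hj h1 hu hv) (h.adj_of_flipArc hj hk h2 hu hv)
    (h.adj_of_flipArc hk hi h3 hu hv)

theorem exists_mask (n : ℕ) (p : ℕ → Prop) : ∃ m < 2 ^ n, ∀ i < n, m.testBit i = true ↔ p i := by
  classical
  refine ⟨Nat.ofBits fun i : Fin n => decide (p i), Nat.ofBits_lt_two_pow _, fun i hi => ?_⟩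
  rw [Nat.testBit_ofBits_lt _ _ hi]
  simp

theorem beats_append_of_lt {s : List ℕ} {m i j : ℕ} (hi : i < s.length) (hj : j < s.length) :
    beats (s ++ [m]) i j = beats s i j := by
  simp [beats, List.getElem?_append_left, hi, hj]

/-- A realization of `s` extends to any further vertex. -/
theorem Realizes.extend {V : Type} {T : SimpleDigraph V} (hT : T.IsTournament) {s : List ℕ}
    {f : ℕ → V} (h : Realizes T s f) {w : V} (hw : ∀ i < s.length, f i ≠ w) :
    ∃ m < 2 ^ s.length, (∀ i < s.length, m.testBit i = true ↔ T.Adj w (f i)) ∧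
      Realizes T (s ++ [m]) (Function.update f s.length w) := by
  obtain ⟨m, hm, hmi⟩ := exists_mask s.length fun i => T.Adj w (f i)
  have hf : ∀ i < s.length, Function.update f s.length w i = f i := fun i hi =>
    Function.update_of_ne hi.ne _ _
  have hn : Function.update f s.length w s.length = w := Function.update_self ..
  have hlast : ∀ i < s.length, beats (s ++ [m]) s.length i = m.testBit i := fun i hi => by
    simp [beats, hi, hi.le]
  have hlast' : ∀ i < s.length, beats (s ++ [m]) i s.length = !m.testBit i := fun i hi => by
    simp [beats, hi]
  refine ⟨m, hm, hmi, ?_, ?_⟩ <;> simp only [List.length_append, List.length_singleton] <;>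
    intro i hi j hj
  · rcases Nat.lt_succ_iff_lt_or_eq.1 hi with hi | rfl <;>
      rcases Nat.lt_succ_iff_lt_or_eq.1 hj with hj | rfl
    · rw [hf i hi, hf j hj]
      exact h.inj i hi j hj
    · rw [hf i hi, hn]
      exact fun h => (hw i hi h).elim
    · rw [hf j hj, hn]
      exact fun h => (hw j hj h.symm).elim
    · exact fun _ => rfl
  · rcases Nat.lt_succ_iff_lt_or_eq.1 hi with hi | rfl <;>
      rcases Nat.lt_succ_iff_lt_or_eq.1 hj with hj | rfl
    · rw [hf i hi, hf j hj, beats_append_of_lt hi hj]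
      exact h.adj i hi j hj
    · rw [hf i hi, hn, hlast' i hi]
      have h1 := hmi i hi
      have h2 := hT.1 _ _ (hw i hi)
      have h3 := hT.2 (f i) w
      cases hb : m.testBit i <;> simp_all
    · rw [hf j hj, hn, hlast j hj]
      exact (hmi j hj).symm
    · simp [beats, T.loopless]

theorem noMonoTriangle_of_isColouring {V : Type} {A : V → V → Prop} {g : ℕ → ℕ → Bool}
    {n m : ℕ} (hm : isColouring g n m = true) {idx : V → ℕ} (hidx : ∀ x, idx x < n)
    (hA : ∀ x y, A x y → g (idx x) (idx y) = true) :
    NoMonoTriangle A fun x => if m.testBit (idx x) then 0 else 1 := by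
  intro a b c hab hbc hca h1 h2
  dsimp only at h1 h2
  simp only [isColouring, List.all_eq_true, List.mem_range] at hm
  have h3 := hm _ (hidx a) _ (hidx b)
  simp only [hA _ _ hab, Bool.not_true, Bool.or_false, Bool.or_eq_true, List.all_eq_true,
    List.mem_range] at h3
  rcases h3 with h3 | h3
  · revert h1 h3
    cases m.testBit (idx a) <;> cases m.testBit (idx b) <;> simp
  · have h4 := h3 _ (hidx c)
    simp only [hA _ _ hbc, hA _ _ hca] at h4
    revert h2 h4
    cases m.testBit (idx b) <;> cases m.testBit (idx c) <;> simp

/-- A realization of a 2-colourable code in a tournament that is not 2-dicolourable misses a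
vertex. -/
theorem Realizes.exists_ne {V : Type} {T : SimpleDigraph V} {s : List ℕ} {f : ℕ → V}
    (h : Realizes T s f) {m : ℕ} (hm : isColouring (beats s) s.length m = true)
    (hT : ∀ φ, ¬ NoMonoTriangle T.Adj φ) : ∃ w, ∀ i < s.length, f i ≠ w := by
  by_contra! hcon
  choose idx hidx hf using hcon
  exact hT _ <| noMonoTriangle_of_isColouring hm hidx fun x y hxy =>
    (h.adj _ (hidx x) _ (hidx y)).1 (by rwa [hf, hf])

theorem Realizes.exists_pairwise {V : Type} {T : SimpleDigraph V} {s : List ℕ} {f : ℕ → V}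
    (h : Realizes T s f) : ∀ (k : ℕ) (L : List ℕ), (∀ x ∈ L, x < s.length) →
      hasTransitive (beats s) k L = true →
      ∃ l : List V, l.Pairwise T.Adj ∧ l.length = k ∧ ∀ x ∈ l, ∃ i ∈ L, f i = x := by
  intro k
  induction k with
  | zero => exact fun L _ _ => ⟨[], by simp⟩
  | succ k ih =>
    intro L hL ht
    simp only [hasTransitive, List.any_eq_true] at ht
    obtain ⟨i, hi, ht⟩ := ht
    obtain ⟨l, hl, hlen, hmem⟩ := ih _ (fun x hx => hL x (List.mem_filter.1 hx).1) ht
    refine ⟨f i :: l, List.pairwise_cons.2 ⟨fun y hy => ?_, hl⟩, by simp [hlen], ?_⟩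
    · obtain ⟨j, hj, rfl⟩ := hmem y hy
      rw [List.mem_filter] at hj
      exact (h.adj i (hL i hi) j (hL j hj.1)).2 hj.2
    · intro y hy
      rcases List.mem_cons.1 hy with rfl | hy
      · exact ⟨i, hi, rfl⟩
      · obtain ⟨j, hj, hjy⟩ := hmem y hy
        exact ⟨j, (List.mem_filter.1 hj).1, hjy⟩

theorem exists_realizes_replicate {V : Type} {T : SimpleDigraph V} (hT : T.IsTournament)
    {l : List V} (hl : l.Pairwise T.Adj) {k : ℕ} (hk : l.length = k) (hk0 : 0 < k) :
    ∃ f, Realizes T (List.replicate k 0) f := by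
  have hne : l ≠ [] := by
    rintro rfl
    simp at hk
    omega
  have hlt : ∀ i < k, ∀ j < k, i < j → T.Adj (l.getD i (l.head hne)) (l.getD j (l.head hne)) := by
    intro i hi j hj hij
    subst hk
    rw [List.getD_eq_getElem _ _ hi, List.getD_eq_getElem _ _ hj]
    exact List.pairwise_iff_getElem.1 hl i j hi hj hij
  refine ⟨fun i => l.getD i (l.head hne), ?_, ?_⟩ <;> simp only [List.length_replicate] <;>
    intro i hi j hj
  · intro hij
    rcases lt_trichotomy i j with h | h | h
    · exact (T.loopless _ (hij ▸ hlt i hi j hj h)).elim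
    · exact h
    · exact (T.loopless _ (hij ▸ hlt j hj i hi h)).elim
  · rcases lt_trichotomy i j with h | rfl | h
    · simpa [beats, h, List.getD_replicate, hj] using hlt i hi j hj h
    · simpa [beats] using T.loopless _
    · have h1 := hlt j hj i hi h
      have h2 := hT.2 (l.getD j (l.head hne)) (l.getD i (l.head hne))
      simp only [beats, h, not_lt.2 h.le, if_true, if_false]
      simp [hi]
      tauto

/-! ### The search -/

/-- The code of `R(C3,C3)`. -/
def rotCode : List ℕ := [0, 0, 1, 0, 0, 8, 7]

/-- The code of the Paley tournament `P7`. -/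
def paleyCode : List ℕ := [0, 0, 0, 1, 2, 5, 11]

/-- Whether the vertices of `s` listed in `pos` induce the tournament coded by `t`. -/
def isCopy (s t pos : List ℕ) : Bool :=
  (List.range t.length).all fun i => Nat.blt (pos.getD i 0) s.length &&
    (List.range t.length).all fun j =>
      (i == j || pos.getD i 0 != pos.getD j 0) &&
        beats t i j == beats s (pos.getD i 0) (pos.getD j 0)

/-- One step of the search, which replaces a coded subtournament of a 3-dicritical tournament by
possible extensions. -/
inductive Step
  /-- Add a vertex of a cyclic triangle through the arc `uv` that is monochromatic in some
  2-dicolouring of the tournament without that arc, and discard the extensions that do not stay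
  2-colourable when one of the arcs in `L` is reversed. -/
  | arc (u v : ℕ) (L : List (ℕ × ℕ))
  /-- Add any vertex; this is possible since `m` is a 2-dicolouring. -/
  | vertex (m : ℕ)
  /-- Stop, as there is a copy of `R(C3,C3)` or `P7`. -/
  | copy (pos : List ℕ)

/-- The extensions of `s` by a vertex `w` such that `uvw` can be a monochromatic triangle of a
2-dicolouring of the tournament without the arc `uv`. -/
def arcExtensions (s : List ℕ) (u v : ℕ) : List (List ℕ) :=
  ((List.range (2 ^ s.length)).filter fun m =>
    m.testBit u && !m.testBit v && splitsArc (s ++ [m]) u v [s.length, u, v]).map fun m => s ++ [m]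

/-- Whether all vertices added by `Step.arc u v` are new. -/
def unsatisfied (s : List ℕ) (u v : ℕ) : Bool :=
  (List.range s.length).all fun i => !(beats s v i && beats s i u && splitsArc s u v [i, u, v])

/-- Whether, for each arc `uv` of `s` in the list, reversing it makes `s` 2-colourable with `u` and
`v` of the same colour. -/
def splitsAll (L : List (ℕ × ℕ)) (s : List ℕ) : Bool :=
  L.all fun e => !(Nat.blt e.1 s.length && Nat.blt e.2 s.length && beats s e.1 e.2) ||
    splitsArc s e.1 e.2 [e.1, e.2]

/-- Whether following the given steps, while discarding all codes that do not satisfy `good`,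
refutes all the given codes. -/
def refutes (good : List ℕ → Bool) : List Step → List (List ℕ) → Bool
  | _, [] => true
  | [], _ :: _ => false
  | .arc u v L :: steps, s :: todo =>
    Nat.blt u s.length && Nat.blt v s.length && beats s u v && unsatisfied s u v &&
      refutes good steps
        ((arcExtensions s u v).filter (fun t => good t && splitsAll L t) ++ todo)
  | .vertex m :: steps, s :: todo =>
    isColouring (beats s) s.length m &&
      refutes good steps
        (((List.range (2 ^ s.length)).map fun m => s ++ [m]).filter good ++ todo)
  | .copy pos :: steps, s :: todo =>
    (isCopy s rotCode pos || isCopy s paleyCode pos) && refutes good steps todo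

theorem Realizes.copy {V : Type} {T : SimpleDigraph V} {s t pos : List ℕ} {f : ℕ → V}
    (h : Realizes T s f) (ht : isCopy s t pos = true) :
    Realizes T t fun i => f (pos.getD i 0) := by
  simp only [isCopy, List.all_eq_true, List.mem_range, Bool.and_eq_true, Bool.or_eq_true,
    beq_iff_eq, bne_iff_ne, Nat.blt_eq] at ht
  refine ⟨fun i hi j hj hij => ?_, fun i hi j hj => ?_⟩
  · have h1 := h.inj _ (ht i hi).1 _ (ht j hj).1 hij
    exact (((ht i hi).2 j hj).1).resolve_right fun h2 => h2 h1
  · rw [((ht i hi).2 j hj).2]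
    exact h.adj _ (ht i hi).1 _ (ht j hj).1

theorem Realizes.splitsAll {V : Type} {T : SimpleDigraph V} (hT : T.IsTournament)
    (hc : T.Dicritical3) {s : List ℕ} {f : ℕ → V} (h : Realizes T s f) (L : List (ℕ × ℕ)) :
    splitsAll L s = true := by
  simp only [SimpleDigraph.splitsAll, List.all_eq_true, Bool.or_eq_true, Bool.not_eq_true',
    ← Bool.not_eq_true, Bool.and_eq_true, Nat.blt_eq]
  refine fun e _ => or_iff_not_imp_left.2 fun he => ?_
  obtain ⟨⟨hu, hv⟩, huv⟩ := not_not.1 he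
  obtain ⟨φ, hφ, h0, h1, -⟩ := hc.exists_colouring hT ((h.adj _ hu _ hv).2 huv)
  exact h.splitsArc hu hv hφ (by simp [hu, hv, h0, h1])

theorem not_realizes_of_refutes {V : Type} {T : SimpleDigraph V} (hT : T.IsTournament)
    (hc : T.Dicritical3) (hR : ∀ f, ¬ Realizes T rotCode f) (hP : ∀ f, ¬ Realizes T paleyCode f)
    {good : List ℕ → Bool} (hgood : ∀ s f, Realizes T s f → good s = true) :
    ∀ (steps : List Step) (todo : List (List ℕ)), refutes good steps todo = true →
      ∀ s ∈ todo, ∀ f, ¬ Realizes T s f := by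
  intro steps
  induction steps with
  | nil =>
    rintro (_ | ⟨s, todo⟩) h
    · simp
    · simp [refutes] at h
  | cons step steps ih =>
    rintro (_ | ⟨s, todo⟩) h
    · simp
    suffices h' : (∀ s ∈ todo, ∀ f, ¬ Realizes T s f) ∧ ∀ f, ¬ Realizes T s f by
      intro t ht
      rcases List.mem_cons.1 ht with rfl | ht
      exacts [h'.2, h'.1 t ht]
    cases step with
    | arc u v L =>
      simp only [refutes, Bool.and_eq_true, Nat.blt_eq] at h
      obtain ⟨⟨⟨⟨hu, hv⟩, huv⟩, hsat⟩, h⟩ := h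
      have ih := ih _ h
      refine ⟨fun t ht => ih t (List.mem_append_right _ ht), fun f hf => ?_⟩
      obtain ⟨φ, hφ, h0, h1, w, hvw, hwu, hw⟩ := hc.exists_colouring hT ((hf.adj u hu v hv).2 huv)
      have hnew : ∀ i < s.length, f i ≠ w := by
        rintro i hi rfl
        simp only [unsatisfied, List.all_eq_true, List.mem_range] at hsat
        have h2 := hsat i hi
        rw [(hf.adj v hv i hi).1 hvw, (hf.adj i hi u hu).1 hwu,
          hf.splitsArc hu hv hφ (C := [i, u, v]) (by simp [*])] at h2
        simp at h2
      obtain ⟨m, hm, hmi, hr⟩ := hf.extend hT hnew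
      refine ih _ (List.mem_append_left _ (List.mem_filter.2 ⟨?_, ?_⟩)) _ hr
      on_goal 2 => rw [hgood _ _ hr, hr.splitsAll hT hc, Bool.and_self]
      refine List.mem_map_of_mem (List.mem_filter.2 ⟨List.mem_range.2 hm, ?_⟩)
      have hf' : ∀ i < s.length, Function.update f s.length w i = f i := fun i hi =>
        Function.update_of_ne hi.ne _ _
      rw [(hmi u hu).2 hwu, (Bool.eq_false_iff.2 fun h2 => hT.2 _ _ ⟨hvw, (hmi v hv).1 h2⟩ :
        m.testBit v = false), hr.splitsArc (φ := φ) (by simp; omega) (by simp; omega)]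
      · rfl
      · rwa [hf' u hu, hf' v hv]
      · simp [hf' u hu, hf' v hv, h0, h1, hw]
        omega
    | vertex m =>
      simp only [refutes, Bool.and_eq_true] at h
      obtain ⟨hm, h⟩ := h
      have ih := ih _ h
      refine ⟨fun t ht => ih t (List.mem_append_right _ ht), fun f hf => ?_⟩
      obtain ⟨w, hw⟩ := hf.exists_ne hm fun φ hφ => hc.1 (hφ.dicolourable2 hT)
      obtain ⟨m, hm, -, hr⟩ := hf.extend hT hw
      exact ih _ (List.mem_append_left _ (List.mem_filter.2
        ⟨List.mem_map_of_mem (List.mem_range.2 hm), hgood _ _ hr⟩)) _ hr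
    | copy pos =>
      simp only [refutes, Bool.and_eq_true, Bool.or_eq_true] at h
      refine ⟨ih _ h.2, fun f hf => ?_⟩
      rcases h.1 with h1 | h1
      exacts [hR _ (hf.copy h1), hP _ (hf.copy h1)]

/-- Whether `s` has no transitive subtournament on `k` vertices. -/
def transitiveFree (k : ℕ) (s : List ℕ) : Bool :=
  !hasTransitive (beats s) k (List.range s.length)

theorem Realizes.transitiveFree {V : Type} {T : SimpleDigraph V} {s : List ℕ} {f : ℕ → V}
    (h : Realizes T s f) {k : ℕ} (hk : ∀ l : List V, l.Pairwise T.Adj → l.length ≠ k) :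
    transitiveFree k s = true := by
  rw [SimpleDigraph.transitiveFree, Bool.not_eq_true']
  refine Bool.eq_false_iff.2 fun ht => ?_
  obtain ⟨l, hl, hlk, -⟩ := h.exists_pairwise k _ (fun x hx => List.mem_range.1 hx) ht
  exact hk l hl hlk

/-- The refutation of the transitive tournament on four vertices. -/
def stepsFour : List Step :=
  [.arc 1 2 [(0, 3)], .arc 0 3 [], .arc 2 3 [(0, 4), (1, 5), (0, 1), (0, 6), (5, 4), (6, 4)],
    .arc 1 3 [(7, 6)], .arc 0 2 [(7, 4)],
    .arc 0 4 [(0, 3), (2, 4), (2, 6), (5, 1), (5, 6), (6, 1), (6, 3)], .arc 0 2 [(5, 4), (6, 4)],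
    .arc 0 2 [(5, 4), (0, 3), (1, 3), (5, 6), (6, 4)], .arc 0 1 [(2, 5)],
    .arc 1 2 [(0, 3), (4, 5), (4, 6), (6, 3), (6, 5)], .arc 1 3 [(0, 3), (2, 6), (4, 6), (6, 5)],
    .arc 0 1 [(7, 3)], .arc 2 3 [(6, 0), (6, 1), (0, 2), (4, 0), (4, 1), (4, 5), (4, 6)],
    .arc 1 2 [(5, 3), (7, 6)], .arc 0 2 [(5, 3)], .copy [0, 1, 5, 2, 3, 6, 4],
    .arc 0 2 [(1, 3), (7, 6)], .arc 2 3 [(1, 5), (0, 2), (3, 4), (5, 6), (6, 1)],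
    .arc 1 2 [(0, 3), (0, 6), (5, 4), (5, 6), (6, 4)], .arc 1 3 [(0, 3), (2, 3), (5, 6), (5, 4)],
    .arc 2 3 [(0, 7)], .arc 5 2 [(1, 3), (0, 3), (2, 4), (6, 3)],
    .arc 1 2 [(0, 3), (0, 6), (5, 3), (7, 3)], .arc 0 3 [],
    .arc 1 3 [(4, 5), (0, 2), (0, 3), (4, 6), (6, 5)],
    .arc 4 3 [(0, 3), (4, 1), (0, 6), (2, 5), (2, 6), (6, 1), (6, 5)], .arc 1 3 [(4, 5), (4, 6)],
    .arc 0 1 [(4, 3), (5, 2), (2, 3), (4, 5), (4, 6), (6, 3)], .arc 1 3 [(4, 7)],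
    .arc 0 2 [(6, 7)]]

/-- The refutation of the transitive tournament on three vertices, given the one on four. -/
def stepsThree : List Step :=
  [.arc 0 1 [], .arc 1 2 [], .arc 0 4 [], .vertex 7, .copy [0, 1, 2, 3, 4, 5, 6], .vertex 19,
    .copy [0, 1, 2, 3, 4, 6, 5], .vertex 3, .vertex 3, .arc 4 3 [], .vertex 19,
    .copy [0, 1, 2, 3, 5, 6, 4], .vertex 14, .copy [0, 1, 2, 3, 6, 5, 4], .arc 0 2 [], .arc 3 2 [],
    .vertex 13, .copy [0, 1, 2, 5, 6, 3, 4], .vertex 7, .copy [0, 1, 2, 6, 5, 3, 4], .arc 1 2 [],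
    .vertex 7, .copy [0, 1, 2, 4, 5, 3, 6], .vertex 13, .copy [0, 1, 2, 4, 6, 3, 5], .vertex 5]

/-- The refutation of the empty tournament, given the transitive one on three vertices. -/
def stepsZero : List Step :=
  [.vertex 0, .vertex 0, .arc 0 1 [], .vertex 1, .arc 1 0 [], .vertex 1]

set_option maxRecDepth 100000 in
theorem refutes_stepsFour : refutes (fun _ => true) stepsFour [[0, 0, 0, 0]] = true := by
  decide +kernel

set_option maxRecDepth 100000 in
theorem refutes_stepsThree : refutes (transitiveFree 4) stepsThree [[0, 0, 0]] = true := by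
  decide +kernel

theorem refutes_stepsZero : refutes (transitiveFree 3) stepsZero [[]] = true := by
  decide +kernel

/-! ### The characterization -/

theorem Dicritical3.exists_realizes {V : Type} {T : SimpleDigraph V} (hT : T.IsTournament)
    (hc : T.Dicritical3) : (∃ f, Realizes T rotCode f) ∨ ∃ f, Realizes T paleyCode f := by
  by_contra! hcon
  have step : ∀ {k : ℕ}, 0 < k → (∀ f, ¬ Realizes T (List.replicate k 0) f) →
      ∀ s f, Realizes T s f → transitiveFree k s = true := fun hk h s f hs =>
    hs.transitiveFree fun l hl hlk =>
      let ⟨f, hf⟩ := exists_realizes_replicate hT hl hlk hk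
      h f hf
  have four := step (k := 4) (by simp) <|
    not_realizes_of_refutes hT hc hcon.1 hcon.2 (fun _ _ _ => rfl) _ _ refutes_stepsFour _
      (by simp [List.replicate])
  have three := step (k := 3) (by simp) <|
    not_realizes_of_refutes hT hc hcon.1 hcon.2 four _ _ refutes_stepsThree _
      (by simp [List.replicate])
  obtain ⟨v⟩ : Nonempty V := by
    by_contra hV
    rw [not_nonempty_iff] at hV
    exact hc.1 (NoMonoTriangle.dicolourable2 hT (φ := fun _ => 0) fun a => isEmptyElim a)
  exact not_realizes_of_refutes hT hc hcon.1 hcon.2 three _ _ refutes_stepsZero [] (by simp)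
    (fun _ => v) ⟨by simp, by simp⟩

theorem Realizes.surjective {V : Type} {T : SimpleDigraph V} {s : List ℕ} {f : ℕ → V}
    (h : Realizes T s f) (hc : T.Dicritical3)
    (hs : SimpleDigraph.splits (beats s) (List.range s.length) [] [] = false) (v : V) :
    ∃ i < s.length, f i = v := by
  by_contra! hcon
  obtain ⟨φ, hφ⟩ := hc.exists_colouring_compl v
  rw [splits_of_colouring (n := s.length) (c := φ ∘ f) ?_ _ _ _ (by simp) (by simp) (by simp)] at hs
  · simp at hs
  · intro i hi j hj k hk h1 h2 h3
    exact hφ _ _ _ ⟨(h.adj i hi j hj).2 h1, hcon i hi, hcon j hj⟩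
      ⟨(h.adj j hj k hk).2 h2, hcon j hj, hcon k hk⟩ ⟨(h.adj k hk i hi).2 h3, hcon k hk, hcon i hi⟩

theorem Realizes.iso {V : Type} {T : SimpleDigraph V} {s : List ℕ} {f : ℕ → V}
    (h : Realizes T s f) (hf : ∀ v, ∃ i < s.length, f i = v) {n : ℕ} (hn : s.length = n)
    {D : SimpleDigraph (Fin n)} (hD : ∀ i j : Fin n, D.Adj i j ↔ beats s i j = true) :
    T.Iso D := by
  subst hn
  let e : Fin s.length ≃ V := Equiv.ofBijective (fun i => f i)
    ⟨fun i j hij => Fin.ext (h.inj _ i.2 _ j.2 hij),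
      fun v => let ⟨i, hi, hv⟩ := hf v; ⟨⟨i, hi⟩, hv⟩⟩
  refine ⟨e.symm, fun u v => ?_⟩
  rw [hD, ← h.adj _ (e.symm u).2 _ (e.symm v).2]
  exact iff_of_eq (congrArg₂ T.Adj (e.apply_symm_apply u).symm (e.apply_symm_apply v).symm)

/-- A tournament that is isomorphic to a coded tournament is 3-dicritical if the code is not
2-colourable but becomes 2-colourable when any arc is reversed. -/
theorem Iso.dicritical3 {V : Type} {T : SimpleDigraph V} (hT : T.IsTournament) {s : List ℕ}
    {n : ℕ} (hn : s.length = n) {D : SimpleDigraph (Fin n)} (h : T.Iso D)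
    (hD : ∀ i j : Fin n, D.Adj i j ↔ beats s i j = true)
    (hs : splits (beats s) (List.range s.length) [] [] = false)
    (hrev : ∀ u < s.length, ∀ v < s.length, beats s u v = true →
      ∃ m < 2 ^ s.length, isColouring (flipArc (beats s) u v) s.length m = true) :
    T.Dicritical3 := by
  subst hn
  obtain ⟨e, he⟩ := h
  have hadj : ∀ x y, T.Adj x y ↔ beats s (e x) (e y) = true := fun x y => (he x y).trans (hD _ _)
  refine dicritical3_of_reverseArc hT (fun φ hφ => ?_) fun u v huv => ?_
  · refine Bool.eq_false_iff.1 hs (splits_of_colouring (n := s.length)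
      (c := fun i => if hi : i < s.length then φ (e.symm ⟨i, hi⟩) else 0)
      ?_ _ _ _ (by simp) (by simp) (by simp))
    intro i hi j hj k hk h1 h2 h3
    simp only [hi, hj, hk, dif_pos]
    exact hφ _ _ _ ((hadj _ _).2 (by simpa using h1)) ((hadj _ _).2 (by simpa using h2))
      ((hadj _ _).2 (by simpa using h3))
  · obtain ⟨m, -, hm⟩ := hrev _ (e u).2 _ (e v).2 ((hadj u v).1 huv)
    refine ⟨_, noMonoTriangle_of_isColouring hm (idx := fun x => e x) (fun x => (e x).2) ?_⟩
    have hne : u ≠ v := fun h => T.loopless v (h ▸ huv)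
    have hinj : ∀ x y : V, (e x : ℕ) = e y ↔ x = y := fun x y => by
      rw [Fin.val_inj, e.apply_eq_iff_eq]
    rintro x y (⟨hxy, hxy'⟩ | ⟨rfl, rfl⟩)
    · simp [flipArc, hinj, hxy', (hadj x y).1 hxy]
    · simp [flipArc, hinj, hne, hne.symm]

theorem rotC3C3_adj (i j : Fin 7) : rotC3C3.Adj i j ↔ beats rotCode i j = true := by
  unfold rotC3C3 digraphOfPairs
  revert i j
  decide +kernel

theorem dirP7_adj (i j : Fin 7) : dirP7.Adj i j ↔ beats paleyCode i j = true := by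
  unfold dirP7
  revert i j
  decide +kernel

theorem splits_rotCode : splits (beats rotCode) (List.range rotCode.length) [] [] = false := by
  decide +kernel

theorem splits_paleyCode :
    splits (beats paleyCode) (List.range paleyCode.length) [] [] = false := by
  decide +kernel

theorem exists_isColouring_rotCode : ∀ u < rotCode.length, ∀ v < rotCode.length,
    beats rotCode u v = true → ∃ m < 2 ^ rotCode.length,
      isColouring (flipArc (beats rotCode) u v) rotCode.length m = true := by
  decide +kernel

theorem exists_isColouring_paleyCode : ∀ u < paleyCode.length, ∀ v < paleyCode.length,
    beats paleyCode u v = true → ∃ m < 2 ^ paleyCode.length,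
      isColouring (flipArc (beats paleyCode) u v) paleyCode.length m = true := by
  decide +kernel

end SimpleDigraph

/-- A tournament is 3-dicritical if and only if it is isomorphic to
`R(C3,C3)` or to the Paley tournament `P7`; in particular there are exactly two
3-dicritical tournaments. -/
theorem dicritical3_tournament_characterization
    {V : Type} [Fintype V] (T : SimpleDigraph V) (hT : T.IsTournament) :
    T.Dicritical3 ↔ T.Iso rotC3C3 ∨ T.Iso dirP7 := by
  constructor
  · intro hc
    rcases hc.exists_realizes hT with ⟨f, hf⟩ | ⟨f, hf⟩
    · exact Or.inl (hf.iso (hf.surjective hc SimpleDigraph.splits_rotCode) rfl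
        SimpleDigraph.rotC3C3_adj)
    · exact Or.inr (hf.iso (hf.surjective hc SimpleDigraph.splits_paleyCode) rfl
        SimpleDigraph.dirP7_adj)
  · rintro (h | h)
    · exact h.dicritical3 hT (s := SimpleDigraph.rotCode) rfl SimpleDigraph.rotC3C3_adj
        SimpleDigraph.splits_rotCode SimpleDigraph.exists_isColouring_rotCode
    · exact h.dicritical3 hT (s := SimpleDigraph.paleyCode) rfl SimpleDigraph.dirP7_adj
        SimpleDigraph.splits_paleyCode SimpleDigraph.exists_isColouring_paleyCode
end

section
/- Let H1 and H2 each be one of the digraphs ↔K2 or C3, and let D be a semi-complete digraph containing the directed join H1 ⇒ H2 as a subdigraph. Then D is 3-dicritical if and only if D is isomorphic to the rotative digraph R(H1,H2). -/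
/-- The directed join `H1 ⇒ H2`: disjoint copies of `H1` and `H2` together with all arcs
from the copy of `H1` to the copy of `H2`. -/
def dirJoin {V1 V2 : Type} (H1 : SimpleDigraph V1) (H2 : SimpleDigraph V2) :
    SimpleDigraph (V1 ⊕ V2) where
  Adj x y :=
    match x, y with
    | Sum.inl a, Sum.inl b => H1.Adj a b
    | Sum.inl _, Sum.inr _ => True
    | Sum.inr _, Sum.inl _ => False
    | Sum.inr a, Sum.inr b => H2.Adj a b
  loopless := by
    rintro (a | a) h
    · exact H1.loopless a h
    · exact H2.loopless a h

/-- The rotative digraph `R(H1, H2)`: disjoint copies of `H1` and `H2` and one extra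
vertex `r`, with all arcs from `V(H1)` to `V(H2)`, all arcs from `V(H2)` to `r`, and all
arcs from `r` to `V(H1)`. -/
def rotative {V1 V2 : Type} (H1 : SimpleDigraph V1) (H2 : SimpleDigraph V2) :
    SimpleDigraph (V1 ⊕ V2 ⊕ Unit) where
  Adj x y :=
    match x, y with
    | Sum.inl a, Sum.inl b => H1.Adj a b
    | Sum.inl _, Sum.inr (Sum.inl _) => True
    | Sum.inr (Sum.inl a), Sum.inr (Sum.inl b) => H2.Adj a b
    | Sum.inr (Sum.inl _), Sum.inr (Sum.inr _) => True
    | Sum.inr (Sum.inr _), Sum.inl _ => True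
    | _, _ => False
  loopless := by
    rintro (a | a | a) h
    · exact H1.loopless a h
    · exact H2.loopless a h
    · exact h

namespace SimpleDigraph

open Relation

/-- The arcs of `A` joining two vertices of colour `i`. -/
def ColourClass {V : Type} (A : V → V → Prop) (φ : V → Fin 2) (i : Fin 2) (a b : V) : Prop :=
  A a b ∧ φ a = i ∧ φ b = i

/-- The arcs of `D` other than the arc from `u` to `v`. -/
def DeleteArc {V : Type} (D : SimpleDigraph V) (u v : V) (a b : V) : Prop :=
  D.Adj a b ∧ ¬ (a = u ∧ b = v)

theorem eq_of_ne_of_ne_fin_two {i j k : Fin 2} (hj : j ≠ i) (hk : k ≠ i) : j = k := by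
  omega

theorem acyclicRel_of_rank {V : Type} {A : V → V → Prop} (g : V → ℕ)
    (hg : ∀ a b, A a b → g a < g b) : AcyclicRel A := by
  have key : ∀ a b, TransGen A a b → g a < g b := by
    intro a b h
    induction h with
    | single h => exact hg _ _ h
    | tail _ h ih => exact ih.trans (hg _ _ h)
  exact fun v h => lt_irrefl _ (key v v h)

theorem Dicolourable2Rel.comap {V W : Type} {A : V → V → Prop} {B : W → W → Prop}
    (hA : Dicolourable2Rel A) (f : W → V) (hf : ∀ a b, B a b → A (f a) (f b)) :
    Dicolourable2Rel B := by
  obtain ⟨φ, hφ⟩ := hA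
  exact ⟨φ ∘ f, fun i v h => hφ i (f v)
    (TransGen.lift f (fun a b h => ⟨hf a b h.1, h.2.1, h.2.2⟩) _ _ h)⟩

/-- The properties of `↔K2` and `C3` used below: they contain a closed walk, every nonempty proper
vertex set has an outgoing arc, every vertex has an out-neighbour, and deleting any arc leaves an
acyclic digraph on at most three levels. -/
structure CycleLike {V : Type} (H : SimpleDigraph V) : Prop where
  closed : ∃ v, TransGen H.Adj v v
  cut : ∀ S : V → Prop, (∃ x, S x) → (∃ y, ¬ S y) → ∃ x y, S x ∧ ¬ S y ∧ H.Adj x y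
  out : ∀ a, ∃ b, H.Adj a b
  rank : ∀ a b, H.Adj a b → ∃ f : V → ℕ, (∀ x, f x < 3) ∧
    ∀ x y, H.Adj x y → ¬ (x = a ∧ y = b) → f x < f y

theorem CycleLike.of_iso {V W : Type} {H : SimpleDigraph V} {K : SimpleDigraph W}
    (hK : K.CycleLike) (h : H.Iso K) : H.CycleLike := by
  obtain ⟨e, he⟩ := h
  have he' : ∀ a b, K.Adj a b → H.Adj (e.symm a) (e.symm b) := fun a b hab => by
    simpa [he] using hab
  refine ⟨?_, ?_, ?_, ?_⟩
  · obtain ⟨v, hv⟩ := hK.closed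
    exact ⟨e.symm v, TransGen.lift e.symm he' _ _ hv⟩
  · rintro S ⟨x, hx⟩ ⟨y, hy⟩
    obtain ⟨p, q, hp, hq, hpq⟩ := hK.cut (fun p => S (e.symm p)) ⟨e x, by simpa using hx⟩
      ⟨e y, by simpa using hy⟩
    exact ⟨_, _, hp, hq, he' _ _ hpq⟩
  · intro a
    obtain ⟨b, hb⟩ := hK.out (e a)
    exact ⟨e.symm b, by simpa [he] using hb⟩
  · intro a b hab
    obtain ⟨f, hf, hlt⟩ := hK.rank _ _ ((he a b).1 hab)
    refine ⟨f ∘ e, fun x => hf _, fun x y hxy hne => hlt _ _ ((he x y).1 hxy) ?_⟩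
    simpa using hne

theorem cycleLike_biK2 : biK2.CycleLike := by
  refine ⟨⟨0, .tail (.single (b := 1) ?_) ?_⟩, ?_, ?_, ?_⟩
  · exact Fin.zero_ne_one
  · exact Fin.zero_ne_one.symm
  · rintro S ⟨x, hx⟩ ⟨y, hy⟩
    exact ⟨x, y, hx, hy, fun h => hy (h ▸ hx)⟩
  · exact fun a => ⟨a + 1, show a ≠ a + 1 by revert a; decide⟩
  · intro a b hab
    refine ⟨fun x => if x = a then 1 else 0, fun x => ?_, ?_⟩
    · dsimp only
      split_ifs <;> omega
    · intro x y hxy hne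
      change a ≠ b at hab
      change x ≠ y at hxy
      have hx : x ≠ a := by omega
      have hy : y = a := by omega
      simp [hx, hy]

theorem cycleLike_dirC3 : dirC3.CycleLike := by
  have hadj : ∀ x, dirC3.Adj x (x + 1) := fun x => rfl
  refine ⟨⟨0, .tail (.tail (.single (hadj 0)) (hadj _)) (hadj _)⟩, ?_, fun a => ⟨_, hadj a⟩, ?_⟩
  · rintro S ⟨x, hx⟩ ⟨y, hy⟩
    by_contra! hS
    have step : ∀ z, S z → S (z + 1) := fun z hz => by
      by_contra hz'
      exact hS z _ hz hz' (hadj z)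
    have hcases : ∀ x y : Fin 3, y = x ∨ y = x + 1 ∨ y = x + 1 + 1 := by decide
    rcases hcases x y with rfl | rfl | rfl
    · exact hy hx
    · exact hy (step _ hx)
    · exact hy (step _ (step _ hx))
  · intro a b hab
    change b = a + 1 at hab
    subst hab
    refine ⟨fun x => (x - (a + 1)).val, fun x => (x - (a + 1)).isLt, ?_⟩
    intro x y hxy hne
    change y = x + 1 at hxy
    subst hxy
    have hxa : x ≠ a := fun h => hne ⟨h, by rw [h]⟩
    have key : ∀ a x : Fin 3, x ≠ a → (x - (a + 1)).val < (x + 1 - (a + 1)).val := by decide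
    exact key a x hxa

theorem CycleLike.exists_colour_ne {V W : Type} {H : SimpleDigraph W} (hH : H.CycleLike)
    {A : V → V → Prop} {φ : V → Fin 2} (f : W → V) (hf : ∀ a b, H.Adj a b → A (f a) (f b))
    {i : Fin 2} (hφ : AcyclicRel (ColourClass A φ i)) : ∃ x, φ (f x) ≠ i := by
  by_contra! hmono
  obtain ⟨v, hv⟩ := hH.closed
  exact hφ (f v) (TransGen.lift f (fun a b h => ⟨hf a b h, hmono a, hmono b⟩) _ _ hv)

section Rotative

variable {V1 V2 : Type} {H1 : SimpleDigraph V1} {H2 : SimpleDigraph V2}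

theorem not_dicolourable2_rotative (h1 : H1.CycleLike) (h2 : H2.CycleLike) :
    ¬ (rotative H1 H2).Dicolourable2 := by
  rintro ⟨φ, hφ⟩
  have other : ∀ i j : Fin 2, j ≠ i + 1 → j = i := by decide
  set i := φ (.inr (.inr ())) with hi
  obtain ⟨a, ha⟩ := h1.exists_colour_ne (A := (rotative H1 H2).Adj) Sum.inl (fun _ _ h => h)
    (hφ (i + 1))
  obtain ⟨c, hc⟩ := h2.exists_colour_ne (A := (rotative H1 H2).Adj) (Sum.inr ∘ Sum.inl)
    (fun _ _ h => h) (hφ (i + 1))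
  have ha' := other _ _ ha
  have hc' := other _ _ hc
  have hac : (rotative H1 H2).Adj (.inl a) (.inr (.inl c)) := trivial
  have hcr : (rotative H1 H2).Adj (.inr (.inl c)) (.inr (.inr ())) := trivial
  have hra : (rotative H1 H2).Adj (.inr (.inr ())) (.inl a) := trivial
  exact hφ i (.inl a) (.tail (.tail (.single ⟨hac, ha', hc'⟩) ⟨hcr, hc', rfl⟩) ⟨hra, rfl, ha'⟩)

theorem rotative_deleteArc_rank (h1 : H1.CycleLike) (h2 : H2.CycleLike)
    (p q : V1 ⊕ V2 ⊕ Unit) (hpq : (rotative H1 H2).Adj p q) :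
    ∃ (φ : V1 ⊕ V2 ⊕ Unit → Fin 2) (g : V1 ⊕ V2 ⊕ Unit → ℕ),
      ∀ x y, (rotative H1 H2).DeleteArc p q x y → φ x = φ y → g x < g y := by
  classical
  have rank1 : ∀ a, ∃ f : V1 → ℕ, (∀ x, f x < 3) ∧
      ∀ x y, H1.Adj x y → x ≠ a → f x < f y := fun a => by
    obtain ⟨b, hb⟩ := h1.out a
    obtain ⟨f, hf, hlt⟩ := h1.rank a b hb
    exact ⟨f, hf, fun x y hxy hx => hlt x y hxy fun h => hx h.1⟩
  have rank2 : ∀ a, ∃ f : V2 → ℕ, (∀ x, f x < 3) ∧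
      ∀ x y, H2.Adj x y → x ≠ a → f x < f y := fun a => by
    obtain ⟨b, hb⟩ := h2.out a
    obtain ⟨f, hf, hlt⟩ := h2.rank a b hb
    exact ⟨f, hf, fun x y hxy hx => hlt x y hxy fun h => hx h.1⟩
  have l1 := H1.loopless
  have l2 := H2.loopless
  obtain ⟨a₀, -⟩ := h1.closed
  obtain ⟨c₀, -⟩ := h2.closed
  rcases p with a | c | ⟨⟩ <;> rcases q with b | d | ⟨⟩
  · obtain ⟨f, hf, hlt⟩ := h1.rank a b hpq
    obtain ⟨f', hf', hlt'⟩ := rank2 c₀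
    refine ⟨Sum.elim (fun _ => 0) (Sum.elim (fun y => if y = c₀ then 0 else 1) fun _ => 1),
      Sum.elim f (Sum.elim (fun y => 3 + f' y) fun _ => 6), ?_⟩
    rintro (x | x | ⟨⟩) (y | y | ⟨⟩) ⟨hxy, hne⟩ hφ <;> simp only [rotative] at hxy <;> grind
  · obtain ⟨f, hf, hlt⟩ := rank1 a
    obtain ⟨f', hf', hlt'⟩ := rank2 d
    refine ⟨Sum.elim (fun x => if x = a then 0 else 1)
      (Sum.elim (fun y => if y = d then 0 else 1) fun _ => 0),
      Sum.elim (fun x => if x = a then 20 else f x) (Sum.elim (fun y => 3 + f' y) fun _ => 10), ?_⟩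
    rintro (x | x | ⟨⟩) (y | y | ⟨⟩) ⟨hxy, hne⟩ hφ <;> simp only [rotative] at hxy <;> grind
  · exact hpq.elim
  · exact hpq.elim
  · obtain ⟨f, hf, hlt⟩ := rank1 a₀
    obtain ⟨f', hf', hlt'⟩ := h2.rank c d hpq
    refine ⟨Sum.elim (fun x => if x = a₀ then 0 else 1) (Sum.elim (fun _ => 0) fun _ => 1),
      Sum.elim (fun x => 1 + f x) (Sum.elim (fun y => 4 + f' y) fun _ => 0), ?_⟩
    rintro (x | x | ⟨⟩) (y | y | ⟨⟩) ⟨hxy, hne⟩ hφ <;> simp only [rotative] at hxy <;> grind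
  · obtain ⟨f, hf, hlt⟩ := rank1 a₀
    obtain ⟨f', hf', hlt'⟩ := rank2 c
    refine ⟨Sum.elim (fun x => if x = a₀ then 0 else 1)
      (Sum.elim (fun y => if y = c then 0 else 1) fun _ => 0),
      Sum.elim (fun x => 1 + f x) (Sum.elim (fun y => 4 + f' y) fun _ => 0), ?_⟩
    rintro (x | x | ⟨⟩) (y | y | ⟨⟩) ⟨hxy, hne⟩ hφ <;> simp only [rotative] at hxy <;> grind
  · obtain ⟨f, hf, hlt⟩ := rank1 b
    obtain ⟨f', hf', hlt'⟩ := rank2 c₀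
    refine ⟨Sum.elim (fun x => if x = b then 0 else 1)
      (Sum.elim (fun y => if y = c₀ then 0 else 1) fun _ => 0),
      Sum.elim f (Sum.elim (fun y => 3 + f' y) fun _ => 6), ?_⟩
    rintro (x | x | ⟨⟩) (y | y | ⟨⟩) ⟨hxy, hne⟩ hφ <;> simp only [rotative] at hxy <;> grind
  · exact hpq.elim
  · exact hpq.elim

theorem rotative_exists_out (h1 : H1.CycleLike) (p : V1 ⊕ V2 ⊕ Unit) :
    ∃ q, (rotative H1 H2).Adj p q := by
  rcases p with a | c | ⟨⟩
  · obtain ⟨b, hb⟩ := h1.out a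
    exact ⟨.inl b, hb⟩
  · exact ⟨.inr (.inr ()), trivial⟩
  · obtain ⟨a, -⟩ := h1.closed
    exact ⟨.inl a, trivial⟩

theorem dicritical3_of_iso_rotative (h1 : H1.CycleLike) (h2 : H2.CycleLike) {V : Type}
    {D : SimpleDigraph V} (h : D.Iso (rotative H1 H2)) : D.Dicritical3 := by
  obtain ⟨e, he⟩ := h
  refine ⟨fun hD => not_dicolourable2_rotative h1 h2 (hD.comap e.symm fun a b hab => ?_), ?_⟩
  · simpa [he] using hab
  intro S A hsub hproper
  obtain ⟨u, v, huv, hA⟩ : ∃ u v, D.Adj u v ∧ ¬ A u v := by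
    rcases hproper with hS | hA
    · obtain ⟨u, hu⟩ := (Set.ne_univ_iff_exists_notMem S).1 hS
      obtain ⟨q, hq⟩ := rotative_exists_out (H2 := H2) h1 (e u)
      exact ⟨u, e.symm q, by simpa [he] using hq, fun h => hu (hsub _ _ h).1⟩
    · by_contra! hall
      exact hA (funext₂ fun u v => propext ⟨fun h => (hsub u v h).2.2, hall u v⟩)
  obtain ⟨φ, g, hg⟩ := rotative_deleteArc_rank h1 h2 _ _ ((he u v).1 huv)
  refine ⟨φ ∘ e, fun i => acyclicRel_of_rank (g ∘ e) ?_⟩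
  rintro a b ⟨hab, ha, hb⟩
  refine hg _ _ ⟨(he a b).1 (hsub a b hab).2.2, ?_⟩ (ha.trans hb.symm)
  rintro ⟨hau, hbv⟩
  rw [e.injective hau, e.injective hbv] at hab
  exact hA hab

theorem iso_rotative_of_containsSub (h1 : H1.CycleLike) (h2 : H2.CycleLike) {V : Type}
    {D : SimpleDigraph V} (hD : D.Dicritical3) (h : D.ContainsSub (rotative H1 H2)) :
    D.Iso (rotative H1 H2) := by
  obtain ⟨f, hinj, hf⟩ := h
  have key : ¬ (Set.range f ≠ Set.univ ∨
      (fun x y => ∃ p q, f p = x ∧ f q = y ∧ (rotative H1 H2).Adj p q) ≠ D.Adj) := by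
    intro hproper
    have hcol := hD.2 _ _ (by
      rintro _ _ ⟨p, q, rfl, rfl, hpq⟩
      exact ⟨⟨p, rfl⟩, ⟨q, rfl⟩, hf _ _ hpq⟩) hproper
    exact not_dicolourable2_rotative h1 h2 (hcol.comap f fun p q hpq => ⟨p, q, rfl, rfl, hpq⟩)
  push Not at key
  obtain ⟨hsurj, hadj⟩ := key
  have hbij : Function.Bijective f := ⟨hinj, Set.range_eq_univ.1 hsurj⟩
  refine ⟨(Equiv.ofBijective f hbij).symm, fun u v => ?_⟩
  obtain ⟨p, rfl⟩ := hbij.2 u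
  obtain ⟨q, rfl⟩ := hbij.2 v
  rw [Equiv.ofBijective_symm_apply_apply, Equiv.ofBijective_symm_apply_apply]
  refine ⟨fun huv => ?_, hf p q⟩
  rw [← hadj] at huv
  obtain ⟨p', q', hp, hq, hpq⟩ := huv
  rwa [hinj hp, hinj hq] at hpq

end Rotative

theorem transGen_or_reflTransGen_of_insert_arc {V : Type} {B C : V → V → Prop} {u v : V}
    (hC : ∀ a b, C a b → B a b ∨ (a = u ∧ b = v)) {x y : V} (h : TransGen C x y) :
    TransGen B x y ∨ (ReflTransGen B x u ∧ ReflTransGen B v y) := by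
  induction h with
  | single h =>
    rcases hC _ _ h with h | ⟨rfl, rfl⟩
    · exact .inl (.single h)
    · exact .inr ⟨.refl, .refl⟩
  | tail _ h ih =>
    rcases hC _ _ h with h | ⟨rfl, rfl⟩
    · exact ih.imp (fun ih => ih.tail h) fun ih => ⟨ih.1, ih.2.tail h⟩
    · exact .inr ⟨ih.elim (fun ih => ih.to_reflTransGen) fun ih => ih.1, .refl⟩

/-- Deleting an arc `uv` of a 3-dicritical semi-complete digraph leaves a 2-dicolouring in which
`u` and `v` have the same colour and lie, together with at most one further vertex, on a
monochromatic digon or triangle of the original digraph. -/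
theorem Dicritical3.exists_dicolouring_deleteArc {V : Type} {D : SimpleDigraph V}
    (hD : D.Dicritical3) (hsc : D.SemiComplete) {u v : V} (huv : D.Adj u v) :
    ∃ φ : V → Fin 2, φ v = φ u ∧ (∀ i, AcyclicRel (ColourClass (D.DeleteArc u v) φ i)) ∧
      (D.Adj v u ∨ ∃ w, φ w = φ u ∧ D.Adj v w ∧ D.Adj w u) ∧
      ∀ x, D.Adj u x → D.Adj x v → φ x ≠ φ u := by
  have hne : u ≠ v := by
    rintro rfl
    exact D.loopless _ huv
  obtain ⟨φ, hφ⟩ := hD.2 Set.univ (D.DeleteArc u v)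
    (fun a b h => ⟨trivial, trivial, h.1⟩)
    (.inr fun h => (h ▸ huv : D.DeleteArc u v u v).2 ⟨rfl, rfl⟩)
  have hbad : ¬ ∀ i, AcyclicRel (ColourClass D.Adj φ i) := fun h => hD.1 ⟨φ, h⟩
  unfold AcyclicRel at hbad
  push Not at hbad
  obtain ⟨i, x, hx⟩ := hbad
  have hpath : TransGen (ColourClass (D.DeleteArc u v) φ i) v u := by
    have hins : ∀ a b, ColourClass D.Adj φ i a b →
        ColourClass (D.DeleteArc u v) φ i a b ∨ (a = u ∧ b = v) := fun a b h => by
      by_cases hab : a = u ∧ b = v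
      · exact .inr hab
      · exact .inl ⟨⟨h.1, hab⟩, h.2⟩
    rcases transGen_or_reflTransGen_of_insert_arc hins hx with h | h
    · exact (hφ i x h).elim
    · rcases reflTransGen_iff_eq_or_transGen.1 (h.2.trans h.1) with h | h
      · exact (hne h).elim
      · exact h
  obtain ⟨_, hv, -⟩ := TransGen.head'_iff.1 hpath
  obtain ⟨y, hvy, hyu⟩ := TransGen.tail'_iff.1 hpath
  obtain rfl : φ u = i := hyu.2.2
  refine ⟨φ, hv.2.1, hφ, ?_, ?_⟩
  · rcases reflTransGen_iff_eq_or_transGen.1 hvy with rfl | hvy'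
    · exact .inl hyu.1.1
    · have hyv : y ≠ v := by
        rintro rfl
        exact hφ _ _ hvy'
      have hyu' : y ≠ u := by
        rintro rfl
        exact D.loopless _ hyu.1.1
      rcases hsc v y hyv.symm with h | h
      · exact .inr ⟨y, hyu.2.1, h, hyu.1.1⟩
      · exact (hφ _ _ (hvy'.tail ⟨⟨h, fun h => hyu' h.1⟩, hyu.2.1, hv.2.1⟩)).elim
  · intro x hux hxv hxφ
    refine hφ _ _ ((hpath.tail (c := x) ⟨⟨hux, ?_⟩, rfl, hxφ⟩).tail
      (c := v) ⟨⟨hxv, ?_⟩, hxφ, hv.2.1⟩)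
    · rintro ⟨-, rfl⟩
      exact D.loopless _ hxv
    · rintro ⟨rfl, -⟩
      exact D.loopless _ hux

section Join

variable {V V1 V2 : Type} {H1 : SimpleDigraph V1} {H2 : SimpleDigraph V2} {D : SimpleDigraph V}
  {α : V1 → V} {β : V2 → V}

theorem Dicritical3.exists_back_vertex (hD : D.Dicritical3) (hsc : D.SemiComplete)
    (h1 : H1.CycleLike) (h2 : H2.CycleLike)
    (hα : ∀ a b, H1.Adj a b → D.Adj (α a) (α b)) (hβ : ∀ a b, H2.Adj a b → D.Adj (β a) (β b))
    (hαβ : ∀ a c, D.Adj (α a) (β c)) (hdisj : ∀ a c, α a ≠ β c) :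
    ∃ w a c, (∀ x, α x ≠ w) ∧ (∀ y, β y ≠ w) ∧ D.Adj (β c) w ∧ D.Adj w (α a) := by
  have nonmono : ∀ {a c φ},
      (∀ i, AcyclicRel (ColourClass (D.DeleteArc (α a) (β c)) φ i)) →
      ∀ i, (∃ x, φ (α x) ≠ i) ∧ ∃ y, φ (β y) ≠ i := fun hφ i =>
    ⟨h1.exists_colour_ne α (fun x y h => ⟨hα x y h, fun h => hdisj _ _ h.2⟩) (hφ i),
      h2.exists_colour_ne β (fun x y h => ⟨hβ x y h, fun h => hdisj _ _ h.1.symm⟩) (hφ i)⟩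
  obtain ⟨a, c, hac⟩ : ∃ a c, ¬ D.Adj (β c) (α a) := by
    by_contra! hall
    obtain ⟨a, -⟩ := h1.closed
    obtain ⟨c, -⟩ := h2.closed
    obtain ⟨φ, hφ, hacyc, -⟩ := hD.exists_dicolouring_deleteArc hsc (hαβ a c)
    obtain ⟨⟨a', ha'⟩, c', hc'⟩ := nonmono hacyc (φ (α a))
    refine hacyc (φ (α a')) (α a') (.tail (.single (b := β c') ⟨⟨hαβ a' c', ?_⟩, rfl, ?_⟩)
      ⟨⟨hall a' c', ?_⟩, ?_, rfl⟩)
    · exact fun h => ha' (congrArg φ h.1)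
    · exact eq_of_ne_of_ne_fin_two hc' ha'
    · exact fun h => hdisj _ _ h.1.symm
    · exact eq_of_ne_of_ne_fin_two hc' ha'
  obtain ⟨φ, hφ, hacyc, hw, -⟩ := hD.exists_dicolouring_deleteArc hsc (hαβ a c)
  obtain ⟨w, hwφ, hcw, hwa⟩ := hw.resolve_left hac
  refine ⟨w, a, c, ?_, ?_, hcw, hwa⟩
  · rintro x rfl
    refine hacyc _ _ (.tail (.single (b := β c) ⟨⟨hαβ x c, ?_⟩, hwφ, hφ⟩) ⟨⟨hcw, ?_⟩, hφ, hwφ⟩)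
    · exact fun h => D.loopless _ (h.1 ▸ hwa)
    · exact fun h => hdisj _ _ h.1.symm
  · rintro y rfl
    refine hacyc _ _ (.tail (.single (b := β y) ⟨⟨hαβ a y, ?_⟩, rfl, hwφ⟩) ⟨⟨hwa, ?_⟩, hwφ, rfl⟩)
    · exact fun h => D.loopless _ (h.2 ▸ hcw)
    · exact fun h => hdisj _ _ h.1.symm

theorem Dicritical3.exists_rotor (hD : D.Dicritical3) (hsc : D.SemiComplete)
    (h1 : H1.CycleLike) (h2 : H2.CycleLike)
    (hα : ∀ a b, H1.Adj a b → D.Adj (α a) (α b)) (hβ : ∀ a b, H2.Adj a b → D.Adj (β a) (β b))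
    (hαβ : ∀ a c, D.Adj (α a) (β c)) (hdisj : ∀ a c, α a ≠ β c) :
    ∃ w, (∀ x, α x ≠ w) ∧ (∀ y, β y ≠ w) ∧ (∀ y, D.Adj (β y) w) ∧ ∀ x, D.Adj w (α x) := by
  obtain ⟨w, a₀, c₀, hwα, hwβ, hc₀, ha₀⟩ := hD.exists_back_vertex hsc h1 h2 hα hβ hαβ hdisj
  have to_w : ∀ x, ¬ D.Adj w (α x) → D.Adj (α x) w := fun x h => (hsc _ _ (hwα x)).resolve_right h
  have from_w : ∀ y, ¬ D.Adj (β y) w → D.Adj w (β y) := fun y h => (hsc _ _ (hwβ y)).resolve_left h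
  refine ⟨w, hwα, hwβ, ?_⟩
  by_contra hnot
  have hboth : (∃ b, ¬ D.Adj w (α b)) ∧ ∃ d, ¬ D.Adj (β d) w := by
    by_contra hsome
    by_cases hb : ∃ b, ¬ D.Adj w (α b)
    · have hd : ∀ d, D.Adj (β d) w := by
        by_contra! hd
        exact hsome ⟨hb, hd⟩
      obtain ⟨b, hb⟩ := hb
      obtain ⟨φ, -, hacyc, -, hdet⟩ := hD.exists_dicolouring_deleteArc hsc (to_w b hb)
      have hne : ∀ y, φ (β y) ≠ φ (α b) := fun y => hdet _ (hαβ b y) (hd y)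
      obtain ⟨y, hy⟩ := h2.exists_colour_ne β
        (fun x y h => ⟨hβ x y h, fun h => hwβ _ h.2⟩) (hacyc (φ (β c₀)))
      exact hy (eq_of_ne_of_ne_fin_two (hne _) (hne _))
    · push Not at hb
      have hd : ∃ d, ¬ D.Adj (β d) w := by
        by_contra! hd
        exact hnot ⟨hd, hb⟩
      obtain ⟨d, hd⟩ := hd
      obtain ⟨φ, -, hacyc, -, hdet⟩ := hD.exists_dicolouring_deleteArc hsc (from_w d hd)
      have hne : ∀ x, φ (α x) ≠ φ w := fun x => hdet _ (hb x) (hαβ x d)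
      obtain ⟨x, hx⟩ := h1.exists_colour_ne α
        (fun x y h => ⟨hα x y h, fun h => hwα _ h.1⟩) (hacyc (φ (α a₀)))
      exact hx (eq_of_ne_of_ne_fin_two (hne _) (hne _))
  obtain ⟨b, a, hb, ha, hba⟩ := h1.cut (fun x => ¬ D.Adj w (α x)) hboth.1
    ⟨a₀, not_not.2 ha₀⟩
  obtain ⟨c, d, hc, hd, hcd⟩ := h2.cut (fun y => D.Adj (β y) w) ⟨c₀, hc₀⟩ hboth.2
  rw [not_not] at ha
  obtain ⟨φ, -, hacyc, -, hdet⟩ := hD.exists_dicolouring_deleteArc hsc (hαβ b d)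
  have hw := hdet w (to_w b hb) (from_w d hd)
  have hcφ := hdet (β c) (hαβ b c) (hβ c d hcd)
  have haφ := hdet (α a) (hα b a hba) (hαβ a d)
  have hcw := eq_of_ne_of_ne_fin_two hcφ hw
  have haw := eq_of_ne_of_ne_fin_two haφ hw
  refine hacyc (φ w) w (.tail (.tail (.single (b := α a) ⟨⟨ha, ?_⟩, rfl, haw⟩)
    (c := β c) ⟨⟨hαβ a c, ?_⟩, haw, hcw⟩) ⟨⟨hc, ?_⟩, hcw, rfl⟩)
  · exact fun h => hwα _ h.1.symm
  · exact fun h => haφ (congrArg φ h.1)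
  · exact fun h => hdisj _ _ h.1.symm

theorem Dicritical3.containsSub_rotative (hD : D.Dicritical3) (hsc : D.SemiComplete)
    (h1 : H1.CycleLike) (h2 : H2.CycleLike) (hjoin : D.ContainsSub (dirJoin H1 H2)) :
    D.ContainsSub (rotative H1 H2) := by
  obtain ⟨f, hinj, hf⟩ := hjoin
  obtain ⟨w, hwα, hwβ, hβw, hwα'⟩ := hD.exists_rotor (α := f ∘ Sum.inl) (β := f ∘ Sum.inr) hsc
    h1 h2 (fun a b h => hf _ _ h) (fun a b h => hf _ _ h) (fun a c => hf (.inl a) (.inr c) trivial)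
    (fun a c h => Sum.inl_ne_inr (hinj h))
  refine ⟨Sum.elim (f ∘ Sum.inl) (Sum.elim (f ∘ Sum.inr) fun _ => w), ?_, ?_⟩
  · refine (hinj.comp Sum.inl_injective).sumElim
      ((hinj.comp Sum.inr_injective).sumElim (fun _ _ _ => rfl) fun y _ => hwβ y) ?_
    rintro a (c | ⟨⟩)
    · exact fun h => Sum.inl_ne_inr (hinj h)
    · exact hwα a
  · rintro (a | a | ⟨⟩) (b | b | ⟨⟩) hab
    · exact hf _ _ hab
    · exact hf (.inl a) (.inr b) trivial
    · exact hab.elim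
    · exact hab.elim
    · exact hf (.inr a) (.inr b) hab
    · exact hβw a
    · exact hwα' b
    · exact hab.elim
    · exact hab.elim

end Join

end SimpleDigraph


/-- Let `H1` and `H2` each be (a copy of) `↔K2` or `C3`, and let `D` be
a semi-complete digraph containing the directed join `H1 ⇒ H2` as a subdigraph. Then `D`
is 3-dicritical if and only if `D` is isomorphic to the rotative digraph `R(H1, H2)`. -/
theorem dicritical3_of_contains_dirJoin
    {V1 V2 : Type} (H1 : SimpleDigraph V1) (H2 : SimpleDigraph V2)
    (h1 : H1.Iso biK2 ∨ H1.Iso dirC3) (h2 : H2.Iso biK2 ∨ H2.Iso dirC3)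
    {V : Type} [Fintype V] (D : SimpleDigraph V) (hsc : D.SemiComplete)
    (hjoin : D.ContainsSub (dirJoin H1 H2)) :
    D.Dicritical3 ↔ D.Iso (rotative H1 H2) := by
  have c1 : H1.CycleLike := h1.elim (SimpleDigraph.cycleLike_biK2.of_iso ·)
    (SimpleDigraph.cycleLike_dirC3.of_iso ·)
  have c2 : H2.CycleLike := h2.elim (SimpleDigraph.cycleLike_biK2.of_iso ·)
    (SimpleDigraph.cycleLike_dirC3.of_iso ·)
  exact ⟨fun hD => SimpleDigraph.iso_rotative_of_containsSub c1 c2 hD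
      (hD.containsSub_rotative hsc c1 c2 hjoin),
    SimpleDigraph.dicritical3_of_iso_rotative c1 c2⟩
end

section
/- Let D be a 3-dicritical semi-complete digraph. Then D does not contain the transitive tournament TT8 on eight vertices as an induced subdigraph. -/
/-- The transitive tournament `TT8` on eight vertices. -/
def dirTT8 : SimpleDigraph (Fin 8) :=
  ⟨fun u v => u < v, fun v h => lt_irrefl v h⟩

/-- The relation `R` has no directed cycle of length two or three inside `P`. -/
def ShortAcyclicOn {α : Type*} (R : α → α → Prop) (P : α → Prop) : Prop :=
  ∀ x y, P x → P y → R x y → ¬ R y x ∧ ∀ z, P z → R y z → ¬ R z x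

/-- The relation `R` with the arc `(u, v)` replaced by the arc `(v, u)`. -/
def flipArc {α : Type*} (R : α → α → Prop) (u v : α) (x y : α) : Prop :=
  (R x y ∧ ¬ (x = u ∧ y = v)) ∨ (x = v ∧ y = u)

/-- `P` is the colour class of `u` and `v` in a colouring that becomes valid once the arc
`(u, v)` is reversed. -/
structure IsArcColouring {α : Type*} (R : α → α → Prop) (u v : α) (P : α → Prop) : Prop where
  left : P u
  right : P v
  acyclic : ShortAcyclicOn (flipArc R u v) P
  acyclic_compl : ShortAcyclicOn (flipArc R u v) (fun x => ¬ P x)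

theorem ShortAcyclicOn.of_transGen {α : Type*} {R B : α → α → Prop} {P : α → Prop}
    (hB : ∀ x, ¬ Relation.TransGen B x x)
    (h : ∀ x y, P x → P y → R x y → Relation.TransGen B x y) : ShortAcyclicOn R P :=
  fun x y hx hy hxy =>
    ⟨fun hyx => hB x ((h x y hx hy hxy).trans (h y x hy hx hyx)), fun z hz hyz hzx =>
      hB x (((h x y hx hy hxy).trans (h y z hy hz hyz)).trans (h z x hz hx hzx))⟩

theorem ShortAcyclicOn.comap {α β : Type*} {R : α → α → Prop} {S : β → β → Prop} {P : α → Prop}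
    {Q : β → Prop} (f : α → β) (h : ShortAcyclicOn S Q) (hPQ : ∀ x, P x → Q (f x))
    (hRS : ∀ x y, P x → P y → R x y → S (f x) (f y)) : ShortAcyclicOn R P := by
  intro x y hx hy hxy
  obtain ⟨h₁, h₂⟩ := h (f x) (f y) (hPQ x hx) (hPQ y hy) (hRS x y hx hy hxy)
  exact ⟨fun hyx => h₁ (hRS y x hy hx hyx), fun z hz hyz hzx =>
    h₂ (f z) (hPQ z hz) (hRS y z hy hz hyz) (hRS z x hz hx hzx)⟩

/-- Outside the colour class of `u` and `v`, reversing the arc `(u, v)` changes nothing. -/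
theorem IsArcColouring.shortAcyclicOn_compl {α : Type*} {R : α → α → Prop} {u v : α}
    {P Q : α → Prop} (h : IsArcColouring R u v P) (hQ : ∀ x, Q x → ¬ P x) :
    ShortAcyclicOn R Q :=
  h.acyclic_compl.comap id hQ fun x _ hx _ hxy => Or.inl ⟨hxy, fun e => hQ x hx ((show x = u from e.1) ▸ h.left)⟩

/-- A walk either avoids the arc `(u, v)` or splits into a walk to `u` and a walk from `v`
avoiding it. -/
theorem transGen_avoiding_arc {α : Type*} {R B : α → α → Prop} {u v : α}
    (hRB : ∀ x y, R x y → B x y ∨ (x = u ∧ y = v)) {x y : α} (h : Relation.TransGen R x y) :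
    Relation.TransGen B x y ∨ (Relation.ReflTransGen B x u ∧ Relation.ReflTransGen B v y) := by
  induction h with
  | single h =>
    rcases hRB _ _ h with h | ⟨rfl, rfl⟩
    · exact Or.inl (.single h)
    · exact Or.inr ⟨.refl, .refl⟩
  | tail _ h ih =>
    rcases hRB _ _ h with h | ⟨rfl, rfl⟩
    · rcases ih with ih | ⟨ih₁, ih₂⟩
      · exact Or.inl (ih.tail h)
      · exact Or.inr ⟨ih₁, ih₂.tail h⟩
    · rcases ih with ih | ⟨ih₁, _⟩
      · exact Or.inr ⟨ih.to_reflTransGen, .refl⟩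
      · exact Or.inr ⟨ih₁, .refl⟩

namespace SimpleDigraph

variable {V : Type} {D : SimpleDigraph V}

/-- Deleting an arc `(u, v)` of a 3-dicritical digraph leaves a colouring in which `u` and `v`
share their colour and are joined by a monochromatic walk from `v` to `u`. -/
theorem Dicritical3.exists_colouring_transGen (hD : D.Dicritical3) {u v : V} (huv : D.Adj u v) :
    ∃ φ : V → Fin 2, φ v = φ u ∧
      (∀ i, AcyclicRel fun a b => (D.Adj a b ∧ ¬ (a = u ∧ b = v)) ∧ φ a = i ∧ φ b = i) ∧
      Relation.TransGen
        (fun a b => (D.Adj a b ∧ ¬ (a = u ∧ b = v)) ∧ φ a = φ u ∧ φ b = φ u) v u := by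
  obtain ⟨φ, hφ⟩ := hD.2 Set.univ (fun a b => D.Adj a b ∧ ¬ (a = u ∧ b = v))
    (fun a b h => ⟨Set.mem_univ _, Set.mem_univ _, h.1⟩)
    (Or.inr fun h => by simpa [huv] using congrFun (congrFun h u) v)
  have hne : v ≠ u := fun h => D.loopless u (h ▸ huv)
  have hnot : ¬ ∀ i, AcyclicRel fun a b => D.Adj a b ∧ φ a = i ∧ φ b = i :=
    fun h => hD.1 ⟨φ, h⟩
  unfold AcyclicRel at hnot
  push Not at hnot
  obtain ⟨i, x, hx⟩ := hnot
  by_cases hi : φ u = i ∧ φ v = i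
  · obtain ⟨rfl, hv⟩ := hi
    refine ⟨φ, hv, hφ, ?_⟩
    rcases transGen_avoiding_arc (u := u) (v := v)
      (B := fun a b => (D.Adj a b ∧ ¬ (a = u ∧ b = v)) ∧ φ a = φ u ∧ φ b = φ u)
      (fun a b h => by tauto) hx with h | ⟨h₁, h₂⟩
    · exact absurd h (hφ _ x)
    · exact ((Relation.reflTransGen_iff_eq_or_transGen.1 (h₂.trans h₁)).resolve_left
        (fun h => hne h.symm))
  · refine absurd (Relation.TransGen.mono (fun a b h => ⟨⟨h.1, ?_⟩, h.2⟩) _ _ hx) (hφ i x)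
    rintro ⟨rfl, rfl⟩
    exact hi h.2

/-- In a 3-dicritical semi-complete digraph every arc `(u, v)` has an arc colouring. The vertices
between `u` and `v` avoid the class of `u`, and this class closes `(u, v)` to a directed triangle
when `(v, u)` is not an arc. -/
theorem Dicritical3.exists_arcColouring (hD : D.Dicritical3) (hsc : D.SemiComplete) {u v : V}
    (huv : D.Adj u v) :
    ∃ P, IsArcColouring D.Adj u v P ∧ (∀ t, D.Adj u t → D.Adj t v → ¬ P t) ∧
      (¬ D.Adj v u → ∃ w, P w ∧ D.Adj v w ∧ D.Adj w u) := by
  obtain ⟨φ, hv, hφ, hpath⟩ := hD.exists_colouring_transGen huv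
  set B : V → V → Prop :=
    fun a b => (D.Adj a b ∧ ¬ (a = u ∧ b = v)) ∧ φ a = φ u ∧ φ b = φ u with hB
  have hBacyc : ∀ x, ¬ Relation.TransGen B x x := hφ (φ u)
  refine ⟨fun x => φ x = φ u, ⟨rfl, hv, ?_, ?_⟩, ?_, ?_⟩
  · refine .of_transGen hBacyc fun x y hx hy hxy => ?_
    rcases hxy with hxy | ⟨rfl, rfl⟩
    · exact .single ⟨hxy, hx, hy⟩
    · exact hpath
  · refine .of_transGen (hφ (φ u + 1)) fun x y hx hy hxy => .single ?_
    have hother : ∀ i j : Fin 2, i ≠ j → i = j + 1 := by decide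
    rcases hxy with hxy | ⟨rfl, rfl⟩
    · exact ⟨hxy, hother _ _ hx, hother _ _ hy⟩
    · exact absurd hv hx
  · intro t hut htv ht
    have h₁ : B u t := ⟨⟨hut, fun h => D.loopless v (h.2 ▸ htv)⟩, rfl, ht⟩
    have h₂ : B t v := ⟨⟨htv, fun h => D.loopless u (h.1 ▸ hut)⟩, ht, hv⟩
    exact hBacyc u (.head h₁ (.head h₂ hpath))
  · intro hvu
    have hmiddle : ∀ x, Relation.TransGen B x u → B v x → ∃ w, B v w ∧ B w u := by
      intro x hx
      induction hx using Relation.TransGen.head_induction_on with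
      | single h => exact fun hvx => ⟨_, hvx, h⟩
      | @head x y hxy hyu ih =>
        intro hvx
        have hvy : v ≠ y := by
          rintro rfl
          exact hBacyc _ (.head hvx (.single hxy))
        rcases hsc v y hvy with h | h
        · exact ih ⟨⟨h, fun e => hBacyc u (e.1 ▸ hpath)⟩, hv, hxy.2.2⟩
        · have hyv : B y v := ⟨⟨h, fun e => hBacyc u (e.1 ▸ hyu)⟩, hxy.2.2, hv⟩
          exact absurd (.head hvx (.head hxy (.single hyv))) (hBacyc v)
    obtain ⟨x, hvx, hxu⟩ := Relation.TransGen.head'_iff.1 hpath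
    rcases Relation.reflTransGen_iff_eq_or_transGen.1 hxu with rfl | hxu
    · exact absurd hvx.1.1 hvu
    · obtain ⟨w, h₁, h₂⟩ := hmiddle x hxu hvx
      exact ⟨w, h₁.2.2, h₁.1.1, h₂.1.1⟩

end SimpleDigraph

/-- A finite digraph on vertices below `16`, as bit tables of out- and in-neighbourhoods: bit
`16 * x + y` of `out` (of `inn`) records the arc `(x, y)` (the arc `(y, x)`). -/
structure ArcTable where
  out : ℕ
  inn : ℕ

/-- The neighbourhood of `x` in a bit table. -/
def bitRow (m x : ℕ) : ℕ :=
  Nat.mod (Nat.shiftRight m (Nat.mul 16 x)) 65536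

/-- Evaluate a natural number before passing it on. -/
def evalFirst {α : Type*} (n : ℕ) (k : ℕ → α) : α :=
  Nat.rec (k 0) (fun m _ => k (Nat.succ m)) n

/-- Some element of the bit set `S` satisfies `p`; the first argument bounds the search. -/
def anyBit (k S : ℕ) (p : ℕ → Bool) : Bool :=
  Nat.rec (fun _ => false)
    (fun _ ih S => bif Nat.beq S 0 then false else
      p (Nat.log2 S) || evalFirst (Nat.xor S (Nat.shiftLeft 1 (Nat.log2 S))) ih) k S

namespace ArcTable

/-- Add the arc `(p, q)`, then continue with `k`. -/
def add {α : Type*} (s : ArcTable) (p q : ℕ) (k : ArcTable → α) : α :=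
  evalFirst (Nat.lor s.out (Nat.shiftLeft 1 (Nat.add (Nat.mul 16 p) q))) fun a =>
    evalFirst (Nat.lor s.inn (Nat.shiftLeft 1 (Nat.add (Nat.mul 16 q) p))) fun b => k ⟨a, b⟩

/-- The bit set `S` contains a directed cycle of length two or three. -/
def hasShortCycle (s : ArcTable) (S : ℕ) : Bool :=
  anyBit 16 S fun x =>
    evalFirst (Nat.land (bitRow s.inn x) S) fun b =>
      anyBit 16 (Nat.land (bitRow s.out x) S) fun y =>
        Nat.ble 1 (Nat.land (Nat.lor (bitRow s.out y) (Nat.shiftLeft 1 y)) b)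

/-- The arc `(p, q)` lies in a digraph formed by a directed cycle of length two or three, a vertex
`u` dominating it, a vertex `v` dominated by it, and the arc `(u, v)`. -/
def obstructed (s : ArcTable) (p q : ℕ) : Bool :=
  evalFirst (bitRow s.out p) fun op => evalFirst (bitRow s.inn p) fun ip =>
  evalFirst (bitRow s.out q) fun oq => evalFirst (bitRow s.inn q) fun iq =>
  evalFirst (Nat.land op oq) fun V => evalFirst (Nat.land ip iq) fun U =>
    anyBit 16 (Nat.land ip (Nat.lor oq (Nat.shiftLeft 1 q))) (fun z =>
      evalFirst (Nat.land V (bitRow s.out z)) fun W =>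
        anyBit 16 (Nat.land U (bitRow s.inn z)) fun u =>
          Nat.ble 1 (Nat.land (bitRow s.out u) W)) ||
    anyBit 16 V (fun y => evalFirst (bitRow s.out y) fun oy => evalFirst (Nat.land V oy) fun W =>
      bif Nat.beq W 0 then false else
        anyBit 16 (Nat.land (Nat.land iq op) (Nat.lor oy (Nat.shiftLeft 1 y))) fun z =>
          Nat.ble 1 (Nat.land W (bitRow s.out z))) ||
    anyBit 16 U (fun y => evalFirst (bitRow s.inn y) fun iy => evalFirst (Nat.land U iy) fun W =>
      bif Nat.beq W 0 then false else
        anyBit 16 (Nat.land (Nat.land op iq) (Nat.lor iy (Nat.shiftLeft 1 y))) fun z =>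
          Nat.ble 1 (Nat.land W (bitRow s.inn z))) ||
    hasShortCycle s (Nat.land op iq)

/-- No colouring has `u`, `v`, `w` in one class and becomes valid once the arc `(u, v)` is
reversed, where `(v, w)` and `(w, u)` are arcs. -/
def conflict (s : ArcTable) (u v w : ℕ) : Bool :=
  evalFirst (bitRow s.out u) fun ou => evalFirst (bitRow s.inn v) fun iv =>
  evalFirst (bitRow s.out w) fun ow => evalFirst (bitRow s.inn w) fun iw =>
    evalFirst (Nat.lor (Nat.lor (Nat.land ow iv) (Nat.land ou iw)) (Nat.lor (Nat.land ou iv)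
      (Nat.lor (Nat.land ow iw) (Nat.lor (Nat.land ou (bitRow s.inn u))
        (Nat.land iv (bitRow s.out v)))))) fun F =>
    evalFirst (Nat.xor F (Nat.land F (Nat.lor (Nat.shiftLeft 1 u) (Nat.shiftLeft 1 v))))
      fun F => Nat.ble 1 (Nat.land F (Nat.shiftLeft 1 w)) || hasShortCycle s F

/-- Orient the pairs formed by the vertex `n` and the vertices below `t` other than `u` and `v` in
all unobstructed ways, and run `k` on each result that is free of conflicts. -/
def branch {σ : Type*} (k : ArcTable → σ → Option σ) (n u v : ℕ) :
    ℕ → ArcTable → σ → Option σ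
  | 0, s, c => bif conflict s u v n then some c else k s c
  | t + 1, s, c =>
    bif Nat.beq t u || Nat.beq t v then branch k n u v t s c else
      match s.add n t fun h => bif obstructed h n t then some c else branch k n u v t h c with
      | none => none
      | some d => s.add t n fun h => bif obstructed h t n then some d else branch k n u v t h d

/-- None of the vertices from `8` to `n - 1` closes the arc `(u, v)` to a directed triangle. -/
def noOldWitness (s : ArcTable) (u v : ℕ) : ℕ → Bool
  | 0 => true
  | w + 1 =>
    bif Nat.blt w 8 then true else
      (s.add v w fun h => h.add w u fun h => conflict h u v w) && noOldWitness s u v w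

/-- Refute the digraph `s` on `n` vertices by closing arcs of the initial transitive tournament to
directed triangles. The arcs are read from the given list, in depth-first order, and the unread
part of the list is returned. -/
def refute : ℕ → ℕ → ArcTable → List (ℕ × ℕ) → Option (List (ℕ × ℕ))
  | 0, _, _, _ => none
  | _, _, _, [] => none
  | k + 1, n, s, (u, v) :: c =>
    bif Nat.blt u v && (Nat.blt v 8 && noOldWitness s u v n) then
      s.add v n fun h => h.add n u fun h => evalFirst (Nat.succ n) fun N =>
        branch (refute k N) n u v n h c
    else none

/-- The transitive tournament on `{0, …, 7}`. -/
def transitive : ArcTable :=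
  ⟨10141436919715339448345687752958,
    659426692445638484587826374860931072⟩

end ArcTable
/-- The arcs closed to directed triangles in the refutation, in depth-first order. -/
def refutationArcs : List (ℕ × ℕ) :=
  [(4, 5), (2, 3), (0, 2), (0, 2), (4, 6), (3, 6), (0, 2), (3, 4), (1, 2), (3, 4), (0, 4),
   (4, 5), (2, 3), (2, 3), (2, 3), (2, 3), (3, 4), (2, 3), (0, 1), (3, 4), (1, 2), (0, 3),
   (0, 4), (2, 3), (6, 7), (6, 7), (6, 7), (3, 4), (3, 4), (3, 4), (2, 3), (2, 3), (2, 3),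
   (2, 4), (3, 4), (2, 3), (0, 4), (0, 5), (0, 2), (0, 2), (6, 7), (4, 5), (5, 6), (4, 5),
   (5, 6), (6, 7), (6, 7), (5, 6), (5, 6), (1, 4), (0, 5), (0, 5), (0, 5), (0, 2), (3, 5),
   (2, 4), (6, 7), (5, 6), (5, 6), (2, 3), (6, 7), (2, 6), (5, 6), (5, 6), (2, 5), (4, 5),
   (2, 3), (5, 6), (5, 6), (6, 7), (5, 6), (5, 6), (6, 7), (5, 6), (5, 6), (6, 7), (5, 6),
   (5, 6), (6, 7), (3, 6), (3, 5), (2, 3), (0, 1), (5, 6), (5, 6), (2, 3), (0, 1), (5, 6)]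

theorem testBit_land (a b i : ℕ) :
    (Nat.land a b).testBit i = true ↔ a.testBit i = true ∧ b.testBit i = true := by
  change (a &&& b).testBit i = true ↔ _
  simp

theorem testBit_lor (a b i : ℕ) :
    (Nat.lor a b).testBit i = true ↔ a.testBit i = true ∨ b.testBit i = true := by
  change (a ||| b).testBit i = true ↔ _
  simp

theorem testBit_xor (a b i : ℕ) :
    (Nat.xor a b).testBit i = (a.testBit i ^^ b.testBit i) :=
  Nat.testBit_xor a b i

theorem testBit_xor_land (a b i : ℕ) :
    (Nat.xor a (Nat.land a b)).testBit i = true ↔ a.testBit i = true ∧ ¬ b.testBit i = true := by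
  change (a ^^^ (a &&& b)).testBit i = true ↔ _
  rw [Nat.testBit_xor, Nat.testBit_and]
  cases a.testBit i <;> cases b.testBit i <;> decide

theorem testBit_shiftLeft_one (x i : ℕ) :
    (Nat.shiftLeft 1 x).testBit i = true ↔ i = x := by
  change (1 <<< x).testBit i = true ↔ _
  rw [Nat.one_shiftLeft, Nat.testBit_two_pow]
  simp [eq_comm]

theorem exists_testBit_of_one_le {a : ℕ} (h : Nat.ble 1 a = true) :
    ∃ i, a.testBit i = true :=
  Nat.exists_testBit_of_ne_zero (Nat.one_le_iff_ne_zero.1 (Nat.le_of_ble_eq_true h))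

theorem testBit_bitRow (m x y : ℕ) :
    (bitRow m x).testBit y = true ↔ y < 16 ∧ m.testBit (16 * x + y) = true := by
  change ((m >>> (16 * x)) % 2 ^ 16).testBit y = true ↔ _
  rw [Nat.testBit_mod_two_pow, Nat.testBit_shiftRight, Bool.and_eq_true, decide_eq_true_eq]

theorem eq_true_of_bif_false {a b : Bool} (h : (bif a then false else b) = true) : b = true := by
  cases a
  · exact h
  · cases h

theorem evalFirst_eq {α : Type*} (n : ℕ) (k : ℕ → α) : evalFirst n k = k n := by
  cases n <;> rfl

theorem exists_of_anyBit {k S : ℕ} {p : ℕ → Bool} (h : anyBit k S p = true) :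
    ∃ x, S.testBit x = true ∧ p x = true := by
  induction k generalizing S with
  | zero => cases h
  | succ k ih =>
    change (bif Nat.beq S 0 then false else p (Nat.log2 S) ||
      evalFirst (Nat.xor S (Nat.shiftLeft 1 (Nat.log2 S))) (anyBit k · p)) = true at h
    rw [evalFirst_eq] at h
    by_cases hS : S = 0
    · subst hS
      cases h
    · have hlog : S.testBit (Nat.log2 S) = true := Nat.testBit_log2 hS
      rcases Bool.or_eq_true_iff.1 (eq_true_of_bif_false h) with h | h
      · exact ⟨_, hlog, h⟩
      · obtain ⟨x, hx, hpx⟩ := ih h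
        refine ⟨x, ?_, hpx⟩
        rw [testBit_xor] at hx
        by_cases hxS : x = Nat.log2 S
        · rwa [hxS]
        · rwa [Bool.eq_false_iff.2 (mt (testBit_shiftLeft_one _ _).1 hxS), Bool.xor_false] at hx

namespace ArcTable

variable {s : ArcTable} {R : ℕ → ℕ → Prop}

/-- Every arc recorded in the table is an arc of `R`. -/
structure Represents (s : ArcTable) (R : ℕ → ℕ → Prop) : Prop where
  out : ∀ {x y}, (bitRow s.out x).testBit y = true → R x y
  inn : ∀ {x y}, (bitRow s.inn x).testBit y = true → R y x

theorem Represents.mono {R' : ℕ → ℕ → Prop} (hs : s.Represents R)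
    (h : ∀ x y, R x y → R' x y) : s.Represents R' :=
  ⟨fun hxy => h _ _ (hs.out hxy), fun hxy => h _ _ (hs.inn hxy)⟩

theorem testBit_bitRow_lor {m x y p q : ℕ} (hq : q < 16)
    (h : (bitRow (Nat.lor m (Nat.shiftLeft 1 (Nat.add (Nat.mul 16 p) q))) x).testBit y = true) :
    (bitRow m x).testBit y = true ∨ (x = p ∧ y = q) := by
  rw [testBit_bitRow, testBit_lor, testBit_shiftLeft_one] at h
  rw [testBit_bitRow]
  obtain ⟨hy, h | h⟩ := h
  · exact Or.inl ⟨hy, h⟩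
  · change 16 * x + y = 16 * p + q at h
    omega

theorem Represents.exists_add {α : Type*} (hs : s.Represents R) {p q : ℕ} (hp : p < 16)
    (hq : q < 16) (hpq : R p q) (k : ArcTable → α) :
    ∃ h : ArcTable, h.Represents R ∧ s.add p q k = k h := by
  refine ⟨⟨_, _⟩, ⟨fun h => ?_, fun h => ?_⟩, by rw [add, evalFirst_eq, evalFirst_eq]⟩
  · rcases testBit_bitRow_lor hq h with h | ⟨rfl, rfl⟩
    · exact hs.out h
    · exact hpq
  · rcases testBit_bitRow_lor hp h with h | ⟨rfl, rfl⟩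
    · exact hs.inn h
    · exact hpq

theorem Represents.not_shortAcyclicOn (hs : s.Represents R) {S : ℕ} {P : ℕ → Prop}
    (hS : ∀ x, S.testBit x = true → P x) (h : s.hasShortCycle S = true) :
    ¬ ShortAcyclicOn R P := by
  intro hP
  obtain ⟨x, hx, h⟩ := exists_of_anyBit h
  rw [evalFirst_eq] at h
  obtain ⟨y, hy, h⟩ := exists_of_anyBit h
  obtain ⟨z, hz⟩ := exists_testBit_of_one_le h
  simp only [testBit_land, testBit_lor, testBit_shiftLeft_one] at hy hz
  obtain ⟨h₁, h₂⟩ := hP x y (hS x hx) (hS y hy.2) (hs.out hy.1)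
  rcases hz with ⟨hz | rfl, hzx, hzS⟩
  · exact h₂ z (hS z hzS) (hs.out hz) (hs.inn hzx)
  · exact h₁ (hs.inn hzx)

/-- Between the ends of any arc there is no directed cycle of length two or three. -/
def ShortAcyclicBetween (R : ℕ → ℕ → Prop) : Prop :=
  ∀ u v, R u v → ShortAcyclicOn R fun t => R u t ∧ R t v

theorem ShortAcyclicBetween.false_of_cycle (hR : ShortAcyclicBetween R) {u v x y z : ℕ}
    (huv : R u v) (hxy : R x y) (hyz : R y z ∨ z = y) (hzx : R z x) (hux : R u x) (huy : R u y)
    (huz : R u z) (hxv : R x v) (hyv : R y v) (hzv : R z v) : False := by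
  obtain ⟨h₁, h₂⟩ := hR u v huv x y ⟨hux, hxv⟩ ⟨huy, hyv⟩ hxy
  rcases hyz with hyz | rfl
  · exact h₂ z ⟨huz, hzv⟩ hyz hzx
  · exact h₁ hzx

theorem Represents.obstructed_eq_false (hs : s.Represents R) (hR : ShortAcyclicBetween R)
    {p q : ℕ} (hpq : R p q) : s.obstructed p q = false := by
  refine Bool.eq_false_iff.2 fun h => ?_
  simp only [obstructed, evalFirst_eq, Bool.or_eq_true] at h
  rcases h with ((h | h) | h) | h
  · obtain ⟨z, hz, h⟩ := exists_of_anyBit h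
    obtain ⟨u, hu, h⟩ := exists_of_anyBit h
    obtain ⟨v, hv⟩ := exists_testBit_of_one_le h
    simp only [testBit_land, testBit_lor, testBit_shiftLeft_one] at hz hu hv
    obtain ⟨⟨hup, huq⟩, huz⟩ := hu
    obtain ⟨huv, ⟨hpv, hqv⟩, hzv⟩ := hv
    exact hR.false_of_cycle (hs.out huv) hpq (hz.2.imp_left hs.out) (hs.inn hz.1) (hs.inn hup)
      (hs.inn huq) (hs.inn huz) (hs.out hpv) (hs.out hqv) (hs.out hzv)
  · obtain ⟨y, hy, h⟩ := exists_of_anyBit h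
    obtain ⟨z, hz, h⟩ := exists_of_anyBit (eq_true_of_bif_false h)
    obtain ⟨v, hv⟩ := exists_testBit_of_one_le h
    simp only [testBit_land, testBit_lor, testBit_shiftLeft_one] at hy hz hv
    obtain ⟨⟨⟨hpv, hqv⟩, hyv⟩, hzv⟩ := hv
    exact hR.false_of_cycle (hs.out hpv) (hs.out hy.2) (hz.2.imp_left hs.out) (hs.inn hz.1.1)
      hpq (hs.out hy.1) (hs.out hz.1.2) (hs.out hqv) (hs.out hyv) (hs.out hzv)
  · obtain ⟨y, hy, h⟩ := exists_of_anyBit h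
    obtain ⟨z, hz, h⟩ := exists_of_anyBit (eq_true_of_bif_false h)
    obtain ⟨u, hu⟩ := exists_testBit_of_one_le h
    simp only [testBit_land, testBit_lor, testBit_shiftLeft_one] at hy hz hu
    obtain ⟨⟨⟨hup, huq⟩, huy⟩, huz⟩ := hu
    exact hR.false_of_cycle (hs.inn huq) (hs.out hz.1.1) (hz.2.imp hs.inn Eq.symm)
      (hs.inn hy.1) (hs.inn hup) (hs.inn huz) (hs.inn huy) hpq (hs.inn hz.1.2) (hs.inn hy.2)
  · refine hs.not_shortAcyclicOn (fun x hx => ?_) h (hR p q hpq)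
    rw [testBit_land] at hx
    exact ⟨hs.out hx.1, hs.inn hx.2⟩

theorem Represents.conflict_eq_false (hs : s.Represents R) (hR : ∀ x, ¬ R x x) {u v w : ℕ}
    {P : ℕ → Prop} (hP : IsArcColouring R u v P) (hw : P w) (hvw : R v w)
    (hwu : R w u) : s.conflict u v w = false := by
  refine Bool.eq_false_iff.2 fun h => ?_
  have hwu' : w ≠ u := fun h => hR u (h ▸ hwu)
  have hwv' : w ≠ v := fun h => hR v (h ▸ hvw)
  have hdigon : ∀ {x t}, P x → t ≠ u → t ≠ v → R x t → R t x → ¬ P t :=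
    fun hx htu htv hxt htx ht => (hP.acyclic _ _ hx ht (Or.inl ⟨hxt, fun e => htv e.2⟩)).1
      (Or.inl ⟨htx, fun e => htu e.1⟩)
  have htriangle : ∀ {x y t}, P x → P y → flipArc R u v x y → t ≠ u → t ≠ v → R y t → R t x →
      ¬ P t :=
    fun hx hy hxy htu htv hyt htx ht => (hP.acyclic _ _ hx hy hxy).2 _ ht
      (Or.inl ⟨hyt, fun e => htv e.2⟩) (Or.inl ⟨htx, fun e => htu e.1⟩)
  simp only [conflict, evalFirst_eq, Bool.or_eq_true] at h
  set F := Nat.xor _ _ with hF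
  have hFP : ∀ t, F.testBit t = true → ¬ P t := by
    intro t ht
    simp only [hF, testBit_xor_land, testBit_land, testBit_lor, testBit_shiftLeft_one,
      not_or] at ht
    obtain ⟨ht, htu, htv⟩ := ht
    rcases ht with (⟨h₁, h₂⟩ | ⟨h₁, h₂⟩) | ⟨h₁, h₂⟩ | ⟨h₁, h₂⟩ | ⟨h₁, h₂⟩ | ⟨h₁, h₂⟩
    · exact htriangle hP.right hw (Or.inl ⟨hvw, fun e => hwv' e.2⟩) htu htv (hs.out h₁) (hs.inn h₂)
    · exact htriangle hw hP.left (Or.inl ⟨hwu, fun e => hwu' e.1⟩) htu htv (hs.out h₁) (hs.inn h₂)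
    · exact htriangle hP.right hP.left (Or.inr ⟨rfl, rfl⟩) htu htv (hs.out h₁) (hs.inn h₂)
    · exact hdigon hw htu htv (hs.out h₁) (hs.inn h₂)
    · exact hdigon hP.left htu htv (hs.out h₁) (hs.inn h₂)
    · exact hdigon hP.right htu htv (hs.out h₂) (hs.inn h₁)
  rcases h with h | h
  · obtain ⟨t, ht⟩ := exists_testBit_of_one_le h
    rw [testBit_land, testBit_shiftLeft_one] at ht
    exact hFP t ht.1 (ht.2 ▸ hw)
  · exact hs.not_shortAcyclicOn hFP h (hP.shortAcyclicOn_compl fun _ hx => hx)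

theorem Represents.exists_of_branch {σ : Type*} {k : ArcTable → σ → Option σ} {n u v : ℕ}
    (hn : n < 16) (hR : ShortAcyclicBetween R)
    (hconflict : ∀ h : ArcTable, h.Represents R → h.conflict u v n = false) {t : ℕ} (htn : t ≤ n)
    (htotal : ∀ x < t, x ≠ u → x ≠ v → R n x ∨ R x n) (hs : s.Represents R) {c : σ}
    (hk : (branch k n u v t s c).isSome = true) :
    ∃ (h : ArcTable) (d : σ), h.Represents R ∧ (k h d).isSome = true := by
  induction t generalizing s c with
  | zero =>
    rw [branch, hconflict s hs] at hk
    exact ⟨s, c, hs, hk⟩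
  | succ t ih =>
    replace ih {s : ArcTable} := @ih s (by omega) fun x hx => htotal x (by omega)
    rw [branch] at hk
    by_cases htuv : t = u ∨ t = v
    · have : (Nat.beq t u || Nat.beq t v) = true := by simpa using htuv
      rw [this] at hk
      exact ih hs hk
    · have : (Nat.beq t u || Nat.beq t v) = false :=
        Bool.eq_false_iff.2 fun h => htuv (by simpa using h)
      rw [this, cond_false] at hk
      rw [not_or] at htuv
      rcases htotal t (by omega) htuv.1 htuv.2 with hnt | hnt
      · obtain ⟨h, hh, heq⟩ := hs.exists_add hn (by omega) hnt
          fun h => bif obstructed h n t then some c else branch k n u v t h c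
        rw [heq, hh.obstructed_eq_false hR hnt, cond_false] at hk
        refine ih hh (c := c) ?_
        cases hb : branch k n u v t h c with
        | none => rw [hb] at hk; exact hk
        | some d => rfl
      · split at hk
        · cases hk
        · next d _ =>
          obtain ⟨h, hh, heq⟩ := hs.exists_add (by omega) hn hnt
            fun h => bif obstructed h t n then some d else branch k n u v t h d
          rw [heq, hh.obstructed_eq_false hR hnt, cond_false] at hk
          exact ih hh hk

theorem exists_conflict_of_noOldWitness {u v n w : ℕ} (hs : s.Represents R)
    (h : s.noOldWitness u v n = true) (hu : u < 16) (hv : v < 16) (hw : 8 ≤ w) (hwn : w < n)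
    (hw16 : w < 16) (hvw : R v w) (hwu : R w u) :
    ∃ h : ArcTable, h.Represents R ∧ h.conflict u v w = true := by
  induction n with
  | zero => omega
  | succ n ih =>
    rw [noOldWitness] at h
    have hn : Nat.blt n 8 = false :=
      Bool.eq_false_iff.2 fun h => by have := Nat.le_of_ble_eq_true h; omega
    rw [hn, cond_false, Bool.and_eq_true] at h
    rcases Nat.lt_succ_iff_lt_or_eq.1 hwn with hwn | rfl
    · exact ih h.2 hwn
    · obtain ⟨h₁, hh₁, heq₁⟩ := hs.exists_add hv hw16 hvw
        fun h => h.add w u fun h => conflict h u v w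
      obtain ⟨h₂, hh₂, heq₂⟩ := hh₁.exists_add hw16 hu hwu fun h => conflict h u v w
      exact ⟨h₂, hh₂, by rw [← heq₂, ← heq₁]; exact h.1⟩

end ArcTable

/-- The arcs of `D` between the first `n` terms of the sequence `f`. -/
def arcsBelow {V : Type} (D : SimpleDigraph V) (f : ℕ → V) (n x y : ℕ) : Prop :=
  x < n ∧ y < n ∧ D.Adj (f x) (f y)

section

variable {V : Type} {D : SimpleDigraph V} {f : ℕ → V} {n : ℕ}

theorem IsArcColouring.comp_arcsBelow {u v : ℕ} {P : V → Prop} (hf : Set.InjOn f (Set.Iio n))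
    (hu : u < n) (hv : v < n) (h : IsArcColouring D.Adj (f u) (f v) P) :
    IsArcColouring (arcsBelow D f n) u v fun x => P (f x) := by
  have hflip : ∀ x y, flipArc (arcsBelow D f n) u v x y →
      flipArc D.Adj (f u) (f v) (f x) (f y) := by
    rintro x y (⟨⟨hx, hy, hxy⟩, hne⟩ | ⟨rfl, rfl⟩)
    · exact Or.inl ⟨hxy, fun e => hne ⟨hf hx hu e.1, hf hy hv e.2⟩⟩
    · exact Or.inr ⟨rfl, rfl⟩
  exact ⟨h.left, h.right, h.acyclic.comap f (fun _ => id) fun x y _ _ => hflip x y,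
    h.acyclic_compl.comap f (fun _ => id) fun x y _ _ => hflip x y⟩

theorem SimpleDigraph.Dicritical3.shortAcyclicBetween (hD : D.Dicritical3)
    (hsc : D.SemiComplete) (f : ℕ → V) (n : ℕ) :
    ArcTable.ShortAcyclicBetween (arcsBelow D f n) := by
  intro u v huv
  obtain ⟨P, hP, hbetween, -⟩ := hD.exists_arcColouring hsc huv.2.2
  exact (hP.shortAcyclicOn_compl (Q := fun t => D.Adj (f u) t ∧ D.Adj t (f v))
    fun t ht => hbetween t ht.1 ht.2).comap f (fun t ht => ⟨ht.1.2.2, ht.2.2.2⟩)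
      fun _ _ _ _ h => h.2.2

/-- A successful refutation of a table excludes it from every sequence of distinct vertices of a
3-dicritical semi-complete digraph starting with a transitive tournament. -/
theorem ArcTable.not_represents_of_refute (hD : D.Dicritical3) (hsc : D.SemiComplete) {k : ℕ}
    {s : ArcTable} {c : List (ℕ × ℕ)} (hnk : n + k ≤ 16) (hn : 8 ≤ n)
    (hf : Set.InjOn f (Set.Iio n)) (hback : ∀ i j, i < j → j < 8 → ¬ D.Adj (f j) (f i))
    (h : (refute k n s c).isSome = true) : ¬ s.Represents (arcsBelow D f n) := by
  induction k generalizing n s c f with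
  | zero => cases h
  | succ k ih =>
    intro hs
    obtain - | ⟨⟨u, v⟩, c⟩ := c
    · cases h
    rw [refute] at h
    cases hcond : Nat.blt u v && (Nat.blt v 8 && noOldWitness s u v n)
    · rw [hcond] at h
      cases h
    rw [hcond, cond_true] at h
    simp only [Bool.and_eq_true, Nat.blt, Nat.ble_eq] at hcond
    obtain ⟨huv, hv, hold⟩ := hcond
    have hadj : D.Adj (f u) (f v) := by
      refine (hsc _ _ fun e => ?_).resolve_right (hback u v huv hv)
      exact Nat.ne_of_lt huv (hf (Set.mem_Iio.2 (by omega)) (Set.mem_Iio.2 (by omega)) e)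
    obtain ⟨P, hP, -, hwit⟩ := hD.exists_arcColouring hsc hadj
    obtain ⟨w, hPw, hvw, hwu⟩ := hwit (hback u v huv hv)
    by_cases hw : ∃ i < n, f i = w
    · obtain ⟨i, hi, rfl⟩ := hw
      have hi8 : 8 ≤ i := by
        by_contra hi8
        have hui : ¬ u < i := fun hui => hback u i hui (by omega) hwu
        refine hback i v ?_ hv hvw
        omega
      have hvi : arcsBelow D f n v i := ⟨by omega, hi, hvw⟩
      have hiu : arcsBelow D f n i u := ⟨hi, by omega, hwu⟩
      obtain ⟨t, ht, hconf⟩ := exists_conflict_of_noOldWitness hs hold (by omega) (by omega) hi8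
        hi (by omega) hvi hiu
      rw [ht.conflict_eq_false (fun x hx => D.loopless _ hx.2.2)
        (hP.comp_arcsBelow hf (by omega) (by omega)) hPw hvi hiu] at hconf
      cases hconf
    · obtain ⟨g, hg, hgn⟩ : ∃ g : ℕ → V, (∀ i < n, g i = f i) ∧ g n = w :=
        ⟨Function.update f n w, fun i hi => Function.update_of_ne hi.ne _ _,
          Function.update_self _ _ _⟩
      have hginj : Set.InjOn g (Set.Iio (n + 1)) := by
        intro i hi j hj hij
        rcases Nat.lt_succ_iff_lt_or_eq.1 hi with hi | rfl <;>
          rcases Nat.lt_succ_iff_lt_or_eq.1 hj with hj | rfl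
        · exact hf hi hj (by rw [← hg i hi, ← hg j hj, hij])
        · exact absurd ⟨i, hi, by rw [← hg i hi, hij, hgn]⟩ hw
        · exact absurd ⟨j, hj, by rw [← hg j hj, ← hij, hgn]⟩ hw
        · rfl
      have hgback : ∀ i j, i < j → j < 8 → ¬ D.Adj (g j) (g i) := fun i j hij hj => by
        rw [hg i (by omega), hg j (by omega)]
        exact hback i j hij hj
      replace hs : s.Represents (arcsBelow D g (n + 1)) := hs.mono fun x y hxy =>
        ⟨by have := hxy.1; omega, by have := hxy.2.1; omega, by
          rw [hg x hxy.1, hg y hxy.2.1]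
          exact hxy.2.2⟩
      rw [← hg u (by omega), ← hgn] at hwu
      rw [← hg v (by omega), ← hgn] at hvw
      rw [← hg u (by omega), ← hg v (by omega)] at hP
      rw [← hgn] at hPw
      have hvn : arcsBelow D g (n + 1) v n := ⟨by omega, by omega, hvw⟩
      have hnu : arcsBelow D g (n + 1) n u := ⟨by omega, by omega, hwu⟩
      simp only [evalFirst_eq] at h
      obtain ⟨s₁, hs₁, heq₁⟩ := hs.exists_add (by omega) (by omega) hvn
        fun h => h.add n u fun h => branch (refute k (Nat.succ n)) n u v n h c
      obtain ⟨s₂, hs₂, heq₂⟩ := hs₁.exists_add (by omega) (by omega) hnu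
        fun h => branch (refute k (Nat.succ n)) n u v n h c
      rw [heq₁, heq₂] at h
      have htotal : ∀ x < n, arcsBelow D g (n + 1) n x ∨ arcsBelow D g (n + 1) x n := by
        intro x hx
        have hne : g n ≠ g x := fun e =>
          hx.ne' (hginj (Set.mem_Iio.2 (by omega)) (Set.mem_Iio.2 (by omega)) e)
        exact (hsc _ _ hne).imp (fun h => ⟨by omega, by omega, h⟩) fun h =>
          ⟨by omega, by omega, h⟩
      obtain ⟨t, d, ht, hd⟩ := hs₂.exists_of_branch (by omega)
        (hD.shortAcyclicBetween hsc g (n + 1))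
        (fun t ht => ht.conflict_eq_false (fun x hx => D.loopless _ hx.2.2)
          (hP.comp_arcsBelow hginj (by omega) (by omega)) hPw hvn hnu)
        le_rfl (fun x hx _ _ => htotal x hx) h
      exact ih (by omega) (by omega) hginj hgback hd ht

end

set_option maxRecDepth 100000 in
theorem refute_transitive :
    (ArcTable.refute 4 8 ArcTable.transitive refutationArcs).isSome = true := by
  decide +kernel

theorem ArcTable.represents_transitive {R : ℕ → ℕ → Prop}
    (hR : ∀ i j, i < j → j < 8 → R i j) : transitive.Represents R := by
  have hout : ∀ x < 8, ∀ y < 16, (bitRow transitive.out x).testBit y = true → x < y ∧ y < 8 := by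
    decide
  have hinn : ∀ x < 8, ∀ y < 16, (bitRow transitive.inn x).testBit y = true → y < x := by
    decide
  have hlt : ∀ {m x y : ℕ}, m < 2 ^ 128 → (bitRow m x).testBit y = true → x < 8 ∧ y < 16 := by
    intro m x y hm h
    rw [testBit_bitRow] at h
    refine ⟨?_, h.1⟩
    by_contra hx
    have : m < 2 ^ (16 * x + y) := hm.trans_le (Nat.pow_le_pow_right two_pos (by omega))
    rw [Nat.testBit_lt_two_pow this] at h
    cases h.2
  constructor
  · intro x y h
    obtain ⟨hx, hy⟩ := hlt (by decide) h
    obtain ⟨h₁, h₂⟩ := hout x hx y hy h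
    exact hR x y h₁ h₂
  · intro x y h
    obtain ⟨hx, hy⟩ := hlt (by decide) h
    exact hR y x (hinn x hx y hy h) hx

/-- A 3-dicritical semi-complete digraph does not contain the transitive
tournament `TT8` on eight vertices as an induced subdigraph. -/
theorem dicritical3_TT8_induced_free
    {V : Type} [Fintype V] (D : SimpleDigraph V) (hD : D.Dicritical3)
    (hsc : D.SemiComplete) :
    ¬ D.ContainsInduced dirTT8 := by
  rintro ⟨f, hf, hadj⟩
  have hmod : ∀ {i}, i < 8 → (Fin.ofNat 8 i).val = i := Nat.mod_eq_of_lt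
  have hiff : ∀ i j, i < 8 → j < 8 →
      (i < j ↔ D.Adj (f (Fin.ofNat 8 i)) (f (Fin.ofNat 8 j))) := by
    intro i j hi hj
    rw [← hadj]
    change _ ↔ (Fin.ofNat 8 i).val < (Fin.ofNat 8 j).val
    rw [hmod hi, hmod hj]
  refine ArcTable.not_represents_of_refute (f := fun i => f (Fin.ofNat 8 i)) hD hsc
    (by decide) le_rfl (fun i hi j hj hij => ?_) (fun i j hij hj h => ?_) refute_transitive
    (ArcTable.represents_transitive fun i j hij hj => ?_)
  · rw [← hmod hi, ← hmod hj, hf hij]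
  · exact hij.asymm ((hiff j i hj (by omega)).2 h)
  · exact ⟨by omega, hj, (hiff i j (by omega) hj).1 hij⟩
end

section
/- Let D be a 3-dicritical semi-complete digraph. Then D does not contain F as a subdigraph, where F is the oriented graph on vertices u1,…,u6, x1, x2, x3 in which {u1,…,u6} induces a transitive tournament with acyclic ordering u1,…,u6 and, for each i ∈ {1,2,3}, the arcs u_{2i} x_i and x_i u_{2i−1} are present. -/
/-- The oriented graph `F` on `Fin 9`: the vertices `0, …, 5` are `u1, …, u6` (inducing a
transitive tournament with acyclic ordering `u1, …, u6`), and the vertices `6, 7, 8` are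
`x1, x2, x3` with arcs `u_{2i} → x_i → u_{2i-1}` for `i ∈ {1, 2, 3}`. -/
def digraphF : SimpleDigraph (Fin 9) :=
  ⟨fun a b => (a.val < b.val ∧ b.val ≤ 5) ∨
      ((a.val, b.val) ∈ [(1,6),(6,0),(3,7),(7,2),(5,8),(8,4)]), by decide⟩

namespace SimpleDigraph

/-- A 2-colouring obtained by deleting the arc `ab` from a digraph that is not 2-dicolourable
leaves `a` and `b` with a common colour, and restricts the colours of short cycles. -/
structure IsArcColouring {V : Type} (D : SimpleDigraph V) (a b : V) (φ : V → Fin 2) : Prop where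
  ends : φ a = φ b
  through : ∀ w, D.Adj a w → D.Adj w b → φ w ≠ φ a
  digon : ∀ x y, D.Adj x y → D.Adj y x → ¬ (x = a ∧ y = b) → ¬ (y = a ∧ x = b) → φ x ≠ φ y
  triangle : ∀ x y z, D.Adj x y → D.Adj y z → D.Adj z x → ¬ (x = a ∧ y = b) →
    ¬ (y = a ∧ z = b) → ¬ (z = a ∧ x = b) → ¬ (φ x = φ y ∧ φ y = φ z)

/-- If adding the arc `ab` to a relation creates a closed walk, then the relation already
contains a walk from `b` to `a`. -/
theorem reflTransGen_of_transGen_insert {V : Type} {R Q : V → V → Prop} {a b : V}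
    (hQ : ∀ x y, Q x y → R x y ∨ (x = a ∧ y = b)) (hR : AcyclicRel R) {v : V}
    (hv : Relation.TransGen Q v v) : Relation.ReflTransGen R b a := by
  have key : ∀ y, Relation.TransGen Q v y → Relation.TransGen R v y ∨
      (Relation.ReflTransGen R v a ∧ Relation.ReflTransGen R b y) := by
    intro y hy
    induction hy with
    | single h =>
      rcases hQ _ _ h with h | ⟨rfl, rfl⟩
      · exact Or.inl (.single h)
      · exact Or.inr ⟨.refl, .refl⟩
    | tail _ h ih =>
      rcases hQ _ _ h with h | ⟨rfl, rfl⟩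
      · exact ih.imp (fun t => t.tail h) (fun t => ⟨t.1, t.2.tail h⟩)
      · exact Or.inr ⟨ih.elim (fun t => t.to_reflTransGen) (fun t => t.1), .refl⟩
  rcases key v hv with h | ⟨h₁, h₂⟩
  · exact (hR v h).elim
  · exact h₂.trans h₁

/-- Every arc `ab` of a 3-dicritical semi-complete digraph has an arc colouring in which it closes
a monochromatic digon or triangle. -/
theorem Dicritical3.exists_isArcColouring {V : Type} {D : SimpleDigraph V} (hD : D.Dicritical3)
    (hsc : D.SemiComplete) {a b : V} (hab : D.Adj a b) :
    ∃ φ : V → Fin 2, D.IsArcColouring a b φ ∧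
      (D.Adj b a ∨ ∃ w, φ w = φ a ∧ D.Adj b w ∧ D.Adj w a) := by
  obtain ⟨φ, hφ⟩ := hD.2 Set.univ (fun x y => D.Adj x y ∧ ¬ (x = a ∧ y = b))
    (fun u v h => ⟨trivial, trivial, h.1⟩)
    (Or.inr fun h => by
      have := congrFun (congrFun h a) b
      simp [hab] at this)
  have hne : a ≠ b := fun h => D.loopless a (by rw [← h] at hab; exact hab)
  have hbad : ∃ i v, Relation.TransGen (fun x y => D.Adj x y ∧ φ x = i ∧ φ y = i) v v := by
    by_contra! h
    exact hD.1 ⟨φ, fun i v => h i v⟩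
  obtain ⟨i, v, hv⟩ := hbad
  obtain ⟨hai, hbi⟩ : φ a = i ∧ φ b = i := by
    by_contra hi
    refine hφ i v (hv.lift id fun x y h => ⟨⟨h.1, ?_⟩, h.2⟩)
    rintro ⟨rfl, rfl⟩
    exact hi h.2
  set R : V → V → Prop := fun x y => (D.Adj x y ∧ ¬ (x = a ∧ y = b)) ∧ φ x = i ∧ φ y = i
  have hR : AcyclicRel R := hφ i
  have hba : Relation.ReflTransGen R b a := reflTransGen_of_transGen_insert
    (Q := fun x y => D.Adj x y ∧ φ x = i ∧ φ y = i)
    (fun x y h => by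
      by_cases he : x = a ∧ y = b
      · exact Or.inr he
      · exact Or.inl ⟨⟨h.1, he⟩, h.2⟩) hR hv
  have hadj : ∀ {x y}, Relation.TransGen R x y → φ y = i := fun h => by
    cases h with
    | single h => exact h.2.2
    | tail _ h => exact h.2.2
  refine ⟨φ, ⟨hai.trans hbi.symm, ?_, ?_, ?_⟩, ?_⟩
  · intro w haw hwb hw
    have hwi : φ w = i := hw.trans hai
    have h₁ : R a w := ⟨⟨haw, fun h => D.loopless b (by rw [h.2] at hwb; exact hwb)⟩, hai, hwi⟩
    have h₂ : R w b := ⟨⟨hwb, fun h => D.loopless a (by rw [h.1] at haw; exact haw)⟩, hwi, hbi⟩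
    exact hR a (((Relation.TransGen.single h₁).tail h₂).trans_left hba)
  · intro x y hxy hyx h₁ h₂ h
    exact hφ (φ y) x ((Relation.TransGen.single ⟨⟨hxy, h₁⟩, h, rfl⟩).tail ⟨⟨hyx, h₂⟩, rfl, h⟩)
  · rintro x y z hxy hyz hzx h₁ h₂ h₃ ⟨h, h'⟩
    exact hφ (φ y) x (((Relation.TransGen.single ⟨⟨hxy, h₁⟩, h, rfl⟩).tail
      ⟨⟨hyz, h₂⟩, rfl, h'.symm⟩).tail ⟨⟨hzx, h₃⟩, h'.symm, h⟩)
  · rcases Relation.reflTransGen_iff_eq_or_transGen.1 hba with h | h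
    · exact (hne h).elim
    · cases h with
      | single h => exact Or.inl h.1.1
      | @tail x _ hbx hxa =>
        refine Or.inr ⟨x, (hadj hbx).trans hai.symm, ?_, hxa.1.1⟩
        have hxb : x ≠ b := by
          rintro rfl
          exact hR x hbx
        have hxna : x ≠ a := by
          rintro rfl
          exact D.loopless x hxa.1.1
        refine (hsc x b hxb).resolve_left fun h => ?_
        exact hR x (Relation.TransGen.head ⟨⟨h, fun h => hxna h.1⟩, hadj hbx, hbi⟩ hbx)

end SimpleDigraph

/-- The set of codes `c < 1024` of 2-colourings of ten vertices, bit `i` of `c` being the colour of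
vertex `i`, in which vertex `i` has colour `false`. Sets of codes are encoded by their bits. -/
def colourMask (i : ℕ) : ℕ := (2 ^ 1024 - 1) / (2 ^ 2 ^ i + 1)

theorem testBit_colourMask {i c : ℕ} (hi : i < 10) (hc : c < 1024) :
    (colourMask i).testBit c = !c.testBit i := by
  have h : ((List.range 10).all fun i => (List.range 1024).all fun c =>
      ((colourMask i).testBit c) ^^ c.testBit i) = true := by decide +kernel
  simp only [List.all_eq_true, List.mem_range] at h
  have := h i hi c hc
  revert this
  cases (colourMask i).testBit c <;> cases c.testBit i <;> simp

/-- The set of colourings in which `i` and `j` receive different colours. -/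
def differMask (i j : ℕ) : ℕ := colourMask i ^^^ colourMask j

theorem testBit_differMask {i j c : ℕ} (hi : i < 10) (hj : j < 10) (hc : c < 1024) :
    (differMask i j).testBit c = (c.testBit i ^^ c.testBit j) := by
  simp [differMask, Nat.testBit_xor, testBit_colourMask, *]

/-- A digraph on the vertices `0, …, n - 1` in which each arc `ab` has a colouring `col a b` with
the properties of an arc colouring. -/
structure IsArcColoured (n : ℕ) (adj : ℕ → ℕ → Prop) (col : ℕ → ℕ → ℕ → Bool) : Prop where
  le : n ≤ 10
  ends : ∀ a < n, ∀ b < n, adj a b → col a b a = col a b b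
  through : ∀ a < n, ∀ b < n, ∀ w < n, adj a b → adj a w → adj w b → col a b w ≠ col a b a
  triangle : ∀ a < n, ∀ b < n, ∀ x < n, ∀ y < n, ∀ z < n, adj a b →
    adj x y → adj y z → adj z x → ¬ (a = x ∧ b = y) → ¬ (a = y ∧ b = z) → ¬ (a = z ∧ b = x) →
    ¬ (col a b x = col a b y ∧ col a b y = col a b z)

/-- Partial information on an arc-coloured digraph on at most ten vertices: the set of arcs known
to be present (the arc `ij` is bit `10 * i + j`), and for some pairs `ab` a set of codes containing
the colouring of `ab` if `ab` is an arc. -/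
structure ArcState where
  arcs : ℕ
  masks : List (ℕ × ℕ × ℕ)

namespace ArcState

def hasArc (s : ArcState) (i j : ℕ) : Bool := s.arcs.testBit (10 * i + j)

/-- Restrict the set `M` of candidates for the colouring of `ab` when the arc `ij` is added,
where `cyc` lists the vertices completing `ij` to a directed triangle. -/
def refineMask (s : ArcState) (i j : ℕ) (cyc : List ℕ) (a b M : ℕ) : ℕ :=
  cyc.foldl (fun M k => bif (a.beq i && b.beq j) || (a.beq j && b.beq k) || (a.beq k && b.beq i)
      then M else M &&& (differMask i j ||| differMask j k))
    (bif (a.beq i && s.hasArc j b) || (b.beq j && s.hasArc a i) then M &&& differMask i j else M)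

def insertArc (n : ℕ) (s : ArcState) (i j : ℕ) : ArcState :=
  let cyc := (List.range n).filter fun k => s.hasArc j k && s.hasArc k i
  ⟨s.arcs ||| 1 <<< (10 * i + j),
    s.masks.map fun p => (p.1, p.2.1, s.refineMask i j cyc p.1 p.2.1 p.2.2)⟩

/-- Some arc has no candidate colouring left. -/
def closed (s : ArcState) : Bool := s.masks.any fun p => p.2.2.beq 0 && s.hasArc p.1 p.2.1

/-- Branch on the orientations of the given pairs until all branches are closed. -/
def refute (n : ℕ) : List (ℕ × ℕ) → ArcState → Bool
  | [], s => s.closed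
  | p :: l, s => s.closed ||
      (refute n l (s.insertArc n p.1 p.2) && refute n l (s.insertArc n p.2 p.1))

/-- The colouring `c` of `ab` is coded by an element of `M`. -/
def Codes (M : ℕ) (c : ℕ → Bool) : Prop := M.testBit (Nat.ofBits fun i : Fin 10 => c i) = true

structure Holds (n : ℕ) (adj : ℕ → ℕ → Prop) (col : ℕ → ℕ → ℕ → Bool) (s : ArcState) : Prop where
  arcs : ∀ i < n, ∀ j < n, s.hasArc i j → adj i j
  masks : ∀ p ∈ s.masks, p.1 < n ∧ p.2.1 < n ∧ (adj p.1 p.2.1 → Codes p.2.2 (col p.1 p.2.1))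

variable {n : ℕ} {adj : ℕ → ℕ → Prop} {col : ℕ → ℕ → ℕ → Bool} {s : ArcState}

theorem testBit_differMask_ofBits {c : ℕ → Bool} {i j : ℕ} (hi : i < 10) (hj : j < 10) :
    (differMask i j).testBit (Nat.ofBits fun i : Fin 10 => c i) = (c i ^^ c j) := by
  rw [testBit_differMask hi hj (Nat.ofBits_lt_two_pow _), Nat.testBit_ofBits_lt _ _ hi,
    Nat.testBit_ofBits_lt _ _ hj]

theorem Codes.and_differMask {M : ℕ} {c : ℕ → Bool} (h : Codes M c) {i j : ℕ} (hi : i < 10)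
    (hj : j < 10) (hij : c i ≠ c j) : Codes (M &&& differMask i j) c := by
  unfold Codes at *
  rw [Nat.testBit_and, h, testBit_differMask_ofBits hi hj]
  simpa using hij

theorem Codes.and_differMask_or {M : ℕ} {c : ℕ → Bool} (h : Codes M c) {i j k : ℕ} (hi : i < 10)
    (hj : j < 10) (hk : k < 10) (hijk : ¬ (c i = c j ∧ c j = c k)) :
    Codes (M &&& (differMask i j ||| differMask j k)) c := by
  unfold Codes at *
  rw [Nat.testBit_and, h, Nat.testBit_or, testBit_differMask_ofBits hi hj,
    testBit_differMask_ofBits hj hk]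
  revert hijk
  cases c i <;> cases c j <;> cases c k <;> simp

theorem Holds.insertArc (hm : IsArcColoured n adj col) (hs : s.Holds n adj col) {i j : ℕ}
    (hi : i < n) (hj : j < n) (hij : adj i j) : (s.insertArc n i j).Holds n adj col := by
  have hn := hm.le
  refine ⟨fun x hx y hy h => ?_, fun q hq => ?_⟩
  · simp only [hasArc, ArcState.insertArc, Nat.testBit_or, Bool.or_eq_true,
      Nat.one_shiftLeft, Nat.testBit_two_pow, decide_eq_true_eq] at h
    rcases h with h | h
    · exact hs.arcs x hx y hy h
    · obtain ⟨rfl, rfl⟩ : i = x ∧ j = y := by omega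
      exact hij
  · obtain ⟨⟨a, b, M⟩, hp, rfl⟩ := List.mem_map.1 hq
    obtain ⟨ha, hb, hM⟩ := hs.masks _ hp
    refine ⟨ha, hb, fun hab => ?_⟩
    replace hM := hM hab
    dsimp only at ha hb hab hM ⊢
    have hcyc : ∀ k ∈ (List.range n).filter fun k => s.hasArc j k && s.hasArc k i,
        k < n ∧ adj j k ∧ adj k i := by
      intro k hk
      simp only [List.mem_filter, List.mem_range, Bool.and_eq_true] at hk
      exact ⟨hk.1, hs.arcs j hj k hk.1 hk.2.1, hs.arcs k hk.1 i hi hk.2.2⟩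
    revert hcyc
    generalize (List.range n).filter (fun k => s.hasArc j k && s.hasArc k i) = cyc
    intro hcyc
    unfold refineMask
    have h₀ : Codes (bif (a.beq i && s.hasArc j b) || (b.beq j && s.hasArc a i)
        then M &&& differMask i j else M) (col a b) := by
      rw [cond_eq_ite]
      split_ifs with h
      · refine hM.and_differMask (by omega) (by omega) ?_
        simp only [Bool.or_eq_true, Bool.and_eq_true, Nat.beq_eq] at h
        rcases h with ⟨rfl, h⟩ | ⟨rfl, h⟩
        · exact (hm.through a ha b hb j hj hab hij (hs.arcs j hj b hb h)).symm
        · rw [← hm.ends a ha b hb hab]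
          exact hm.through a ha b hb i hi hab (hs.arcs a ha i hi h) hij
      · exact hM
    revert h₀
    generalize (bif (a.beq i && s.hasArc j b) || (b.beq j && s.hasArc a i)
        then M &&& differMask i j else M) = M₀
    intro h₀
    induction cyc generalizing M₀ with
    | nil => exact h₀
    | cons k cyc ih =>
      obtain ⟨hk, hjk, hki⟩ := hcyc k (by simp)
      refine ih (fun l hl => hcyc l (by simp [hl])) _ ?_
      beta_reduce
      rw [cond_eq_ite]
      split_ifs with h
      · exact h₀
      · simp only [Bool.or_eq_true, Bool.and_eq_true, Nat.beq_eq, not_or] at h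
        exact h₀.and_differMask_or (by omega) (by omega) (by omega)
          (hm.triangle a ha b hb i hi j hj k hk hab hij hjk hki h.1.1 h.1.2 h.2)

theorem Holds.foldl_insertArc (hm : IsArcColoured n adj col) {l : List (ℕ × ℕ)} :
    ∀ {s : ArcState}, s.Holds n adj col → (∀ p ∈ l, p.1 < n ∧ p.2 < n ∧ adj p.1 p.2) →
      (l.foldl (fun s p => s.insertArc n p.1 p.2) s).Holds n adj col := by
  induction l with
  | nil => exact fun hs _ => hs
  | cons p l ih =>
    intro s hs hl
    obtain ⟨h₁, h₂, h₃⟩ := hl p (by simp)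
    exact ih (hs.insertArc hm h₁ h₂ h₃) fun q hq => hl q (by simp [hq])

theorem Holds.closed_eq_false (hs : s.Holds n adj col) : s.closed = false := by
  rw [Bool.eq_false_iff]
  intro h
  simp only [closed, List.any_eq_true, Bool.and_eq_true, Nat.beq_eq] at h
  obtain ⟨⟨a, b, M⟩, hp, rfl, h⟩ := h
  obtain ⟨ha, hb, hM⟩ := hs.masks _ hp
  simpa [Codes] using hM (hs.arcs a ha b hb h)

theorem Holds.refute_eq_false (hm : IsArcColoured n adj col) {l : List (ℕ × ℕ)} :
    ∀ {s : ArcState}, s.Holds n adj col →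
      (∀ p ∈ l, p.1 < n ∧ p.2 < n ∧ (adj p.1 p.2 ∨ adj p.2 p.1)) → refute n l s = false := by
  induction l with
  | nil => exact fun hs _ => hs.closed_eq_false
  | cons p l ih =>
    intro s hs hl
    obtain ⟨h₁, h₂, h₃⟩ := hl p (by simp)
    have hl' : ∀ q ∈ l, q.1 < n ∧ q.2 < n ∧ (adj q.1 q.2 ∨ adj q.2 q.1) :=
      fun q hq => hl q (by simp [hq])
    rw [refute, hs.closed_eq_false, Bool.false_or, Bool.and_eq_false_iff]
    exact h₃.imp (fun h => ih (hs.insertArc hm h₁ h₂ h) hl')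
      (fun h => ih (hs.insertArc hm h₂ h₁ h) hl')

/-- No arcs are known; the arc `12` lies in a directed triangle `12w` that its colouring makes
monochromatic, and `l` lists the arcs whose colourings are to be tracked. -/
def start (w : ℕ) (l : List (ℕ × ℕ)) : ArcState :=
  ⟨0, l.map fun p => (p.1, p.2, (2 ^ 1024 - 1) ^^^ (differMask p.1 p.2 |||
    bif p.1.beq 1 && p.2.beq 2 then differMask 1 w else 0))⟩

set_option exponentiation.threshold 1024 in
theorem holds_start (hm : IsArcColoured n adj col) {w : ℕ} (hw : w < n)
    (hcol : col 1 2 1 = col 1 2 w) {l : List (ℕ × ℕ)}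
    (hl : ∀ p ∈ l, p.1 < n ∧ p.2 < n) : (start w l).Holds n adj col := by
  have hn := hm.le
  refine ⟨fun i _ j _ h => by simp [hasArc, start] at h, fun q hq => ?_⟩
  obtain ⟨⟨a, b⟩, hp, rfl⟩ := List.mem_map.1 hq
  obtain ⟨ha, hb⟩ := hl _ hp
  refine ⟨ha, hb, fun hab => ?_⟩
  have hlt : (Nat.ofBits fun i : Fin 10 => col a b i) < 1024 := Nat.ofBits_lt_two_pow _
  dsimp only at ha hb hab hlt ⊢
  rw [Codes, Nat.testBit_xor, Nat.testBit_two_pow_sub_one, Nat.testBit_or,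
    testBit_differMask_ofBits (by omega) (by omega), hm.ends a ha b hb hab, cond_eq_ite]
  split_ifs with h
  · simp only [Bool.and_eq_true, Nat.beq_eq] at h
    obtain ⟨rfl, rfl⟩ := h
    rw [testBit_differMask_ofBits (by omega) (by omega), hcol]
    simp [hlt]
  · simp [hlt]

end ArcState

/-- The arcs of `digraphF`. -/
def arcsF : List (ℕ × ℕ) :=
  [(0, 1), (0, 2), (0, 3), (0, 4), (0, 5), (1, 2), (1, 3), (1, 4), (1, 5), (2, 3), (2, 4), (2, 5),
    (3, 4), (3, 5), (4, 5), (1, 6), (6, 0), (3, 7), (7, 2), (5, 8), (8, 4)]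

theorem adj_of_mem_arcsF : ∀ p ∈ arcsF, ∃ i j : Fin 9, p = (i.val, j.val) ∧ digraphF.Adj i j := by
  unfold digraphF
  decide

theorem eq_eight_of_not_adj : ∀ i : Fin 9,
    ¬ digraphF.Adj i 2 → ¬ digraphF.Adj 1 i → i ≠ 1 → i ≠ 2 → i = 8 := by
  unfold digraphF
  decide

/-- Arcs on ten vertices whose colourings suffice for the refutations below. -/
def trackedArcs : List (ℕ × ℕ) :=
  [(0, 2), (0, 3), (0, 4), (0, 5), (0, 7), (0, 8), (0, 9), (1, 2), (1, 4), (1, 6), (1, 7), (2, 4),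
    (2, 5), (2, 8), (2, 9), (3, 9), (6, 5), (6, 7), (7, 4), (7, 5), (7, 8), (7, 9), (8, 2), (8, 3),
    (8, 4), (8, 6), (8, 7), (8, 9), (9, 4), (9, 5), (9, 7), (9, 8)]

namespace ArcState

/-- The arcs of `digraphF` are present, and the colouring of the arc `12` makes a directed triangle
`12w` monochromatic. -/
def initial (n w : ℕ) : ArcState :=
  (arcsF ++ [(2, w), (w, 1)]).foldl (fun s p => s.insertArc n p.1 p.2)
    (start w (trackedArcs.filter fun p => p.1.blt n && p.2.blt n))

theorem refute_initial_nine : refute 9 [(0, 8), (3, 8), (5, 7), (7, 8), (0, 7), (4, 7), (1, 7),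
    (6, 7), (6, 8), (2, 6), (3, 6)] (initial 9 8) = true := by
  decide +kernel

theorem refute_initial_ten : refute 10 [(4, 9), (0, 9), (5, 9), (3, 9), (2, 8), (8, 9), (3, 8),
    (1, 8), (0, 8), (7, 8), (7, 9), (0, 7), (5, 7), (4, 7), (1, 7), (6, 7), (6, 9), (5, 6),
    (2, 6)] (initial 10 9) = true := by
  decide +kernel

end ArcState

namespace SimpleDigraph

variable {V : Type} {D : SimpleDigraph V}

/-- The arc colourings of a 3-dicritical semi-complete digraph, read on `n` of its vertices. -/
theorem Dicritical3.exists_isArcColoured (hD : D.Dicritical3) (hsc : D.SemiComplete) {n : ℕ}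
    (hn : n ≤ 10) {g : ℕ → V} (hg : ∀ i < n, ∀ j < n, g i = g j → i = j) {φ : V → Fin 2}
    (hφ : D.IsArcColouring (g 1) (g 2) φ) :
    ∃ col : ℕ → ℕ → ℕ → Bool, IsArcColoured n (fun i j => D.Adj (g i) (g j)) col ∧
      ∀ i, col 1 2 i = decide (φ (g i) = 0) := by
  have hex : ∀ a b, ∃ ψ : V → Fin 2, (D.Adj (g a) (g b) → D.IsArcColouring (g a) (g b) ψ) ∧
      (a = 1 ∧ b = 2 → ψ = φ) := by
    intro a b
    by_cases h : a = 1 ∧ b = 2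
    · obtain ⟨rfl, rfl⟩ := h
      exact ⟨φ, fun _ => hφ, fun _ => rfl⟩
    · by_cases hab : D.Adj (g a) (g b)
      · obtain ⟨ψ, hψ, -⟩ := hD.exists_isArcColouring hsc hab
        exact ⟨ψ, fun _ => hψ, fun h' => (h h').elim⟩
      · exact ⟨φ, fun h' => (hab h').elim, fun h' => (h h').elim⟩
  choose ψ hψ hψφ using hex
  have hdec : ∀ x y : Fin 2, decide (x = 0) = decide (y = 0) ↔ x = y := by decide
  refine ⟨fun a b i => decide (ψ a b (g i) = 0), ⟨hn, ?_, ?_, ?_⟩, fun i => ?_⟩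
  · intro a _ b _ hab
    exact (hdec _ _).2 (hψ a b hab).ends
  · intro a _ b _ w _ hab haw hwb h
    exact (hψ a b hab).through _ haw hwb ((hdec _ _).1 h)
  · intro a ha b hb x hx y hy z hz hab hxy hyz hzx h₁ h₂ h₃ h
    refine (hψ a b hab).triangle _ _ _ hxy hyz hzx ?_ ?_ ?_
      ⟨(hdec _ _).1 h.1, (hdec _ _).1 h.2⟩
    · exact fun h => h₁ ⟨(hg _ hx _ ha h.1).symm, (hg _ hy _ hb h.2).symm⟩
    · exact fun h => h₂ ⟨(hg _ hy _ ha h.1).symm, (hg _ hz _ hb h.2).symm⟩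
    · exact fun h => h₃ ⟨(hg _ hz _ ha h.1).symm, (hg _ hx _ hb h.2).symm⟩
  · simp only [hψφ 1 2 ⟨rfl, rfl⟩]

/-- A successful refutation excludes the corresponding vertices `g 0, …, g (n - 1)`. -/
theorem Dicritical3.refute_eq_false (hD : D.Dicritical3) (hsc : D.SemiComplete) {n w : ℕ}
    (hn : n ≤ 10) (hw : w < n) (h₂ : 2 < n) {g : ℕ → V}
    (hg : ∀ i < n, ∀ j < n, g i = g j → i = j)
    (hF : ∀ p ∈ arcsF, p.1 < n ∧ p.2 < n ∧ D.Adj (g p.1) (g p.2)) {φ : V → Fin 2}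
    (hφ : D.IsArcColouring (g 1) (g 2) φ) (hφw : φ (g w) = φ (g 1)) (h₂w : D.Adj (g 2) (g w))
    (hw₁ : D.Adj (g w) (g 1)) {l : List (ℕ × ℕ)}
    (hl : ∀ p ∈ l, p.1 < n ∧ p.2 < n ∧ p.1 ≠ p.2) :
    ArcState.refute n l (ArcState.initial n w) = false := by
  obtain ⟨col, hm, hcol⟩ := hD.exists_isArcColoured hsc hn hg hφ
  refine ArcState.Holds.refute_eq_false hm (ArcState.Holds.foldl_insertArc hm
    (ArcState.holds_start hm hw (by rw [hcol, hcol, hφw]) fun p hp => ?_) fun p hp => ?_)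
    fun p hp => ?_
  · simpa only [List.mem_filter, Bool.and_eq_true, Nat.blt_eq] using (List.mem_filter.1 hp).2
  · simp only [List.mem_append, List.mem_cons, List.not_mem_nil, or_false] at hp
    rcases hp with hp | rfl | rfl
    · exact hF p hp
    · exact ⟨h₂, hw, h₂w⟩
    · exact ⟨hw, by omega, hw₁⟩
  · obtain ⟨h, h', hne⟩ := hl p hp
    exact ⟨h, h', hsc _ _ fun he => hne (hg _ h _ h' he)⟩

end SimpleDigraph

/-- A 3-dicritical semi-complete digraph does not contain `F` as a
subdigraph. -/
theorem dicritical3_F_free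
    {V : Type} [Fintype V] (D : SimpleDigraph V) (hD : D.Dicritical3)
    (hsc : D.SemiComplete) :
    ¬ D.ContainsSub digraphF := by
  rintro ⟨f, hf, hadj⟩
  have arc : ∀ i j : Fin 9, i < j → j.val ≤ 5 → D.Adj (f i) (f j) :=
    fun i j h h' => hadj i j (Or.inl ⟨h, h'⟩)
  obtain ⟨φ, hφ, hcl⟩ := hD.exists_isArcColouring hsc (arc 1 2 (by decide) (by decide))
  obtain ⟨w, hw, h₂w, hw₁⟩ : ∃ w, φ w = φ (f 1) ∧ D.Adj (f 2) w ∧ D.Adj w (f 1) := by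
    refine hcl.resolve_left fun h₂₁ => ?_
    obtain ⟨ψ, hψ, -⟩ := hD.exists_isArcColouring hsc (arc 0 5 (by decide) (by decide))
    have h₁ := hψ.through _ (arc 0 1 (by decide) (by decide)) (arc 1 5 (by decide) (by decide))
    have h₂ := hψ.through _ (arc 0 2 (by decide) (by decide)) (arc 2 5 (by decide) (by decide))
    have h₁₂ := hψ.digon _ _ (arc 1 2 (by decide) (by decide)) h₂₁
      (by simp [hf.eq_iff]) (by simp [hf.eq_iff])
    omega
  let g : ℕ → V := fun i => if h : i < 9 then f ⟨i, h⟩ else w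
  have hgf : ∀ i : Fin 9, g i = f i := fun i => by simp [g]
  have hF : ∀ p ∈ arcsF, p.1 < 9 ∧ p.2 < 9 ∧ D.Adj (g p.1) (g p.2) := by
    intro p hp
    obtain ⟨i, j, rfl, hij⟩ := adj_of_mem_arcsF p hp
    exact ⟨i.2, j.2, by rw [hgf, hgf]; exact hadj i j hij⟩
  have hg : ∀ i < 9, ∀ j < 9, g i = g j → i = j := fun i hi j hj h => by
    simpa [g, hi, hj, hf.eq_iff] using h
  by_cases hwf : ∃ i, f i = w
  · obtain ⟨i, rfl⟩ := hwf
    have h₂ : ¬ digraphF.Adj i 2 := fun h => by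
      have hi : i ≠ 2 := fun h' => D.loopless _ (h' ▸ h₂w)
      refine hφ.digon _ _ h₂w (hadj _ _ h) ?_ ?_ (hφ.ends.symm.trans hw.symm)
      · simp [hf.eq_iff]
      · rintro ⟨h', -⟩
        rw [h'] at hw₁
        exact D.loopless _ hw₁
    have h₁ : ¬ digraphF.Adj 1 i := fun h => by
      refine hφ.digon _ _ hw₁ (hadj _ _ h) ?_ ?_ hw
      · simp [hf.eq_iff]
      · rintro ⟨-, h'⟩
        rw [h'] at h₂w
        exact D.loopless _ h₂w
    have h₁' : i ≠ 1 := fun h => D.loopless _ (h ▸ hw₁)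
    have h₂' : i ≠ 2 := fun h => D.loopless _ (h ▸ h₂w)
    obtain rfl : i = 8 := eq_eight_of_not_adj i h₂ h₁ h₁' h₂'
    exact absurd (ArcState.refute_initial_nine.symm.trans
      (hD.refute_eq_false (w := 8) hsc (by decide) (by decide) (by decide) hg hF hφ hw h₂w hw₁
        (by decide)))
      (by decide)
  · have hg' : ∀ i < 10, ∀ j < 10, g i = g j → i = j := by
      intro i hi j hj h
      push Not at hwf
      by_cases hi' : i < 9 <;> by_cases hj' : j < 9
      · exact hg i hi' j hj' h
      · exact (hwf ⟨i, hi'⟩ (by simpa [g, hi', hj'] using h)).elim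
      · exact (hwf ⟨j, hj'⟩ (by simpa [g, hi', hj'] using h.symm)).elim
      · omega
    exact absurd (ArcState.refute_initial_ten.symm.trans
      (hD.refute_eq_false (w := 9) hsc (by decide) (by decide) (by decide) hg'
        (fun p hp => ⟨(hF p hp).1.trans (by decide), (hF p hp).2.1.trans (by decide),
          (hF p hp).2.2⟩)
        hφ hw h₂w hw₁ (by decide)))
      (by decide)
end
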